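/- arXiv:1911.02040 — 11 statements merged into one kernel-verified Lean document; each statement's English description precedes it below -/
import Mathlib

section
/- Every finite simple graph of maximum degree at most 4, equipped with any rotation system, admits an angle cover. -/
open SimpleGraph

/-- A rotation system on a simple graph `G`: for each vertex `v`, a permutation of
`Sym2 V` that fixes all non-incident edges and acts as a single cycle on the set of
edges incident to `v` (a cyclic ordering of the incident edges). -/
structure RotationSystem {V : Type*} (G : SimpleGraph V) where
  rot : V → Equiv.Perm (Sym2 V)
  fixes : ∀ v e, e ∉ G.incidenceSet v → rot v e = e
  cyclic : ∀ v, ∀ e ∈ G.incidenceSet v, ∀ e' ∈ G.incidenceSet v,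
    ∃ n : ℕ, ((rot v) ^ n) e = e'

/-- Two distinct edges incident to `v` are consecutive at `v` if they are adjacent
in the cyclic ordering given by the rotation system. -/
def RotationSystem.Consecutive {V : Type*} {G : SimpleGraph V} (ρ : RotationSystem G)
    (v : V) (e e' : Sym2 V) : Prop :=
  e ≠ e' ∧ e ∈ G.incidenceSet v ∧ e' ∈ G.incidenceSet v ∧
    (ρ.rot v e = e' ∨ ρ.rot v e' = e)

/-- An angle cover: each vertex `v` gets at most two incident edges, pairwise
consecutive at `v`, and every edge is covered at one of its endpoints. -/
def RotationSystem.IsAngleCover {V : Type*} {G : SimpleGraph V} (ρ : RotationSystem G)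
    (A : V → Finset (Sym2 V)) : Prop :=
  (∀ v, (A v).card ≤ 2) ∧
  (∀ v, ∀ e ∈ A v, e ∈ G.incidenceSet v) ∧
  (∀ v, ∀ e ∈ A v, ∀ e' ∈ A v, e ≠ e' → ρ.Consecutive v e e') ∧
  (∀ e ∈ G.edgeSet, ∃ v, v ∈ e ∧ e ∈ A v)

open Classical in
/-- Two fixed-point-free involutions have a common proper 2-colouring. -/
theorem two_color_free {X : Type*} (s t : Equiv.Perm X) (hs : ∀ x, s (s x) = x)
    (ht : ∀ x, t (t x) = x) (hs' : ∀ x, s x ≠ x) (ht' : ∀ x, t x ≠ x) :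
    ∃ c : X → Prop, (∀ x, c (s x) ↔ ¬ c x) ∧ (∀ x, c (t x) ↔ ¬ c x) := by
  let p : Equiv.Perm X := t * s
  have hss : s * s = 1 := by ext x; simp [hs]
  have htt : t * t = 1 := by ext x; simp [ht]
  have hsi : s⁻¹ = s := inv_eq_of_mul_eq_one_left hss
  have hti : t⁻¹ = t := inv_eq_of_mul_eq_one_left htt
  have hconj1 : s * p * s⁻¹ = p⁻¹ := by
    simp only [p, mul_inv_rev, hsi, hti, mul_assoc, hss, mul_one]
  have hconj : ∀ n : ℤ, s * p ^ n = p ^ (-n) * s := by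
    intro n
    have : s * p ^ n * s⁻¹ = p ^ (-n) := by
      rw [← conj_zpow, hconj1, inv_zpow, zpow_neg]
    rw [← this]; group
  have hc : ∀ (n : ℤ) x, s ((p ^ n) x) = (p ^ (-n)) (s x) := fun n x => by
    have := congrArg (fun f : Equiv.Perm X => f x) (hconj n)
    simpa using this
  have key : ∀ x, ¬ p.SameCycle x (s x) := by
    rintro x ⟨n, hn⟩
    rcases Int.even_or_odd' n with ⟨k, rfl | rfl⟩
    · apply hs' ((p ^ k) x)
      rw [hc, ← hn, ← Equiv.Perm.mul_apply, ← zpow_add]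
      congr 2; ring
    · apply ht' (s ((p ^ k) x))
      have h1 : t (s ((p ^ k) x)) = (p ^ (k + 1)) x := by
        rw [add_comm, zpow_add, zpow_one]; rfl
      rw [h1, hc, ← hn, ← Equiv.Perm.mul_apply, ← zpow_add]
      congr 2; ring
  let Q := Quotient (Equiv.Perm.SameCycle.setoid p)
  let q : X → Q := fun x => Quotient.mk _ x
  have hq : ∀ x y, q x = q y ↔ p.SameCycle x y := fun x y => Quotient.eq
  have hqt : ∀ x, q (t x) = q (s x) := by
    intro x
    rw [hq, Equiv.Perm.sameCycle_comm]
    refine ⟨1, ?_⟩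
    simp [p, hs]
  have hqst : ∀ x, q (s (t x)) = q x := by
    intro x
    rw [hq]
    refine ⟨1, ?_⟩
    simp [p, hs, ht]
  have hne : ∀ x, q x ≠ q (s x) := fun x h => key x ((hq _ _).1 h)
  let _ : LinearOrder Q := WellOrderingRel.isWellOrder.linearOrder
  refine ⟨fun x => q x < q (s x), fun x => ?_, fun x => ?_⟩
  · simp only [hs, not_lt]
    exact ⟨le_of_lt, fun h => lt_of_le_of_ne h (hne x).symm⟩
  · simp only [hqt, hqst, not_lt]
    exact ⟨le_of_lt, fun h => lt_of_le_of_ne h (hne x).symm⟩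

open Classical in
/-- Making an involution fixed-point-free by doubling. -/
noncomputable def dbl {X : Type*} (s : X → X) (hs : ∀ x, s (s x) = x) : Equiv.Perm (X × Bool) :=
  Function.Involutive.toPerm
    (fun x => if s x.1 = x.1 then (x.1, !x.2) else (s x.1, x.2)) (by
      rintro ⟨x, b⟩
      by_cases h : s x = x
      · simp [h]
      · have : ¬ x = s x := fun h' => h h'.symm
        simp [h, hs, this])

open Classical in
theorem dbl_apply {X : Type*} (s : X → X) (hs : ∀ x, s (s x) = x) (x : X × Bool) :
    dbl s hs x = if s x.1 = x.1 then (x.1, !x.2) else (s x.1, x.2) := rfl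

theorem two_color {X : Type*} (s t : X → X) (hs : ∀ x, s (s x) = x)
    (ht : ∀ x, t (t x) = x) :
    ∃ c : X → Prop, (∀ x, s x ≠ x → (c (s x) ↔ ¬ c x)) ∧
      (∀ x, t x ≠ x → (c (t x) ↔ ¬ c x)) := by
  have inv : ∀ (s : X → X) (hs : ∀ x, s (s x) = x) x, dbl s hs (dbl s hs x) = x :=
    fun s hs x => Function.Involutive.toPerm_involutive _ x
  have free : ∀ (s : X → X) (hs : ∀ x, s (s x) = x) x, dbl s hs x ≠ x := by
    rintro s hs ⟨x, b⟩
    rw [dbl_apply]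
    by_cases h : s x = x <;> simp [h]
  obtain ⟨c, h1, h2⟩ := two_color_free (dbl s hs) (dbl t ht) (inv s hs) (inv t ht)
    (free s hs) (free t ht)
  refine ⟨fun x => c (x, true), fun x hx => ?_, fun x hx => ?_⟩
  · have := h1 (x, true)
    simpa [dbl_apply, hx] using this
  · have := h2 (x, true)
    simpa [dbl_apply, hx] using this

theorem local_pairing {α : Type*} (r : Equiv.Perm α) (I : Finset α)
    (hr : r.IsCycleOn (I : Set α)) (hfix : ∀ e, e ∉ I → r e = e) (hI : I.card ≤ 4) :
    ∃ t : α → α, (∀ x, t (t x) = x) ∧ ∀ S ⊆ I, (∀ e ∈ S, t e ≠ e → t e ∉ S) →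
      S.card ≤ 2 ∧ ∀ e ∈ S, ∀ e' ∈ S, e ≠ e' → r e = e' ∨ r e' = e := by
  classical
  have hk : ∀ e ∈ I, (r ^ I.card) e = e := fun e he => hr.pow_card_apply he
  have hex : ∀ e ∈ I, ∀ e' ∈ I, ∃ n < I.card, (r ^ n) e = e' :=
    fun e he e' he' => hr.exists_pow_eq he he'
  by_cases h4 : I.card = 4
  · rw [h4] at hk hex
    have hne : ∀ e ∈ I, r (r e) ≠ e := by
      intro e he h
      have := Nat.le_of_dvd (by norm_num)
        ((hr.pow_apply_eq he (n := 2)).1 (by simpa [pow_two] using h))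
      omega
    have hk' : ∀ e ∈ I, r (r (r (r e))) = e := fun e he => by
      simpa [pow_succ] using hk e he
    have hpair : ∀ S ⊆ I, (∀ e ∈ S, r (r e) ≠ e → r (r e) ∉ S) →
        ∀ e ∈ S, ∀ e' ∈ S, e ≠ e' → r e = e' ∨ r e' = e := by
      intro S hS h e he e' he' hee
      obtain ⟨n, hn, hh⟩ := hex e (hS he) e' (hS he')
      have h1 := h e he (hne e (hS he))
      have h2 := hk' e (hS he)
      interval_cases n
      · simp at hh; exact absurd hh hee
      · left; simpa using hh
      · simp [pow_succ] at hh; rw [hh] at h1; exact absurd he' h1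
      · simp [pow_succ] at hh; right; rw [← hh]; exact h2
    refine ⟨fun e => r (r e), ?_, ?_⟩
    · intro x
      by_cases hx : x ∈ I
      · exact hk' x hx
      · simp [hfix x hx]
    · intro S hS h
      refine ⟨?_, hpair S hS h⟩
      by_contra hc
      obtain ⟨a, ha, b, hb, c, hcc, hab, hac, hbc⟩ := Finset.two_lt_card.1 (not_le.1 hc)
      have p1 := hpair S hS h a ha b hb hab
      have p2 := hpair S hS h a ha c hcc hac
      have p3 := hpair S hS h b hb c hcc hbc
      have inj := r.injective
      have q1 := h a ha (hne a (hS ha))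
      have q2 := h b hb (hne b (hS hb))
      have q3 := h c hcc (hne c (hS hcc))
      rcases p1 with p1 | p1 <;> rcases p2 with p2 | p2 <;> rcases p3 with p3 | p3 <;> grind
  · by_cases h3 : I.card = 3
    · rw [h3] at hk hex
      have hne : ∀ e ∈ I, r e ≠ e := by
        intro e he h
        have := Nat.le_of_dvd (by norm_num)
          ((hr.pow_apply_eq he (n := 1)).1 (by simpa using h))
        omega
      have hk' : ∀ e ∈ I, r (r (r e)) = e := fun e he => by
        simpa [pow_succ] using hk e he
      obtain ⟨a, ha⟩ : I.Nonempty := Finset.card_pos.1 (by omega)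
      have hra : r a ∈ I := hr.1.1 ha
      refine ⟨Equiv.swap a (r a), by simp, fun S hS h => ⟨?_, ?_⟩⟩
      · have hlt : S.card < I.card := by
          apply Finset.card_lt_card
          refine ⟨hS, fun hIS => ?_⟩
          have := h a (hIS ha) (by simpa using hne a ha)
          simp at this
          exact this (hIS hra)
        omega
      · intro e he e' he' hee
        obtain ⟨n, hn, hh⟩ := hex e (hS he) e' (hS he')
        have h2 := hk' e (hS he)
        interval_cases n
        · simp at hh; exact absurd hh hee
        · left; simpa using hh
        · simp [pow_succ] at hh; right; rw [← hh]; exact h2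
    · have hI2 : I.card ≤ 2 := by omega
      refine ⟨id, fun _ => rfl, fun S hS _ => ⟨(Finset.card_le_card hS).trans hI2, ?_⟩⟩
      intro e he e' he' hee
      obtain ⟨n, hn, hh⟩ := hex e (hS he) e' (hS he')
      have : n < 2 := by omega
      interval_cases n
      · simp at hh; exact absurd hh hee
      · left; simpa using hh

/-- Every finite simple graph of maximum degree at most 4, with any rotation system,
admits an angle cover. -/
theorem angle_cover_of_maxDegree_le_four {V : Type*} [Fintype V] (G : SimpleGraph V)
    (hdeg : ∀ v, (G.neighborSet v).ncard ≤ 4) (ρ : RotationSystem G) :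
    ∃ A : V → Finset (Sym2 V), ρ.IsAngleCover A := by
  classical
  let I : V → Finset (Sym2 V) := fun v => (G.incidenceSet v).toFinset
  have hI : ∀ v e, e ∈ I v ↔ e ∈ G.incidenceSet v := fun v e => Set.mem_toFinset
  have hcard : ∀ v, (I v).card ≤ 4 := by
    intro v
    have h1 := hdeg v
    rw [← Nat.card_coe_set_eq, ← Nat.card_congr (G.incidenceSetEquivNeighborSet v),
      Nat.card_coe_set_eq, Set.ncard_eq_toFinset_card'] at h1
    exact h1
  have hcyc : ∀ v, (ρ.rot v).IsCycleOn (I v : Set (Sym2 V)) := by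
    intro v
    have hmaps : Set.MapsTo (ρ.rot v) (I v : Set (Sym2 V)) (I v : Set (Sym2 V)) := by
      intro e he
      by_contra hc
      have := ρ.fixes v (ρ.rot v e) (fun h => hc (by simpa [I] using h))
      rw [(ρ.rot v).injective this] at hc
      exact hc he
    constructor
    · refine ⟨hmaps, (ρ.rot v).injective.injOn, ?_⟩
      exact Finset.surjOn_of_injOn_of_card_le _ hmaps (ρ.rot v).injective.injOn le_rfl
    · intro e he e' he'
      obtain ⟨n, hn⟩ := ρ.cyclic v e (by simpa [I] using he) e' (by simpa [I] using he')
      exact ⟨n, by simpa using hn⟩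
  have hloc := fun v => local_pairing (ρ.rot v) (I v) (hcyc v)
    (fun e he => ρ.fixes v e (fun h => he ((hI v e).2 h))) (hcard v)
  choose t ht1 ht2 using hloc
  let s : V × Sym2 V → V × Sym2 V := fun x => if h : x.1 ∈ x.2 then (Sym2.Mem.other' h, x.2) else x
  have hs : ∀ x, s (s x) = x := by
    rintro ⟨v, e⟩
    by_cases h : v ∈ e
    · have h' := Sym2.other_mem' h
      have := Sym2.other_invol' h h'
      simp [s, h, h', this]
    · simp [s, h]
  obtain ⟨c, hc1, hc2⟩ := two_color s (fun x => (x.1, t x.1 x.2)) hs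
    (fun x => by simp [ht1])
  have hS := fun v => ht2 v ((I v).filter (fun e => c (v, e))) (Finset.filter_subset _ _) (by
    intro e he hne h
    have h1 := hc2 (v, e) (by simpa using hne)
    have h2 := (Finset.mem_filter.1 he).2
    have h3 := (Finset.mem_filter.1 h).2
    exact h1.1 h3 h2)
  refine ⟨fun v => (I v).filter (fun e => c (v, e)), fun v => (hS v).1, ?_, ?_, ?_⟩
  · intro v e he
    exact (hI v e).1 (Finset.mem_filter.1 he).1
  · intro v e he e' he' hne
    exact ⟨hne, (hI v e).1 (Finset.mem_filter.1 he).1, (hI v e').1 (Finset.mem_filter.1 he').1,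
      (hS v).2 e he e' he' hne⟩
  · intro e he
    induction e using Sym2.ind with
    | _ a b =>
    have hab : G.Adj a b := he
    have hsa : s (a, s(a, b)) = (b, s(a, b)) := by
      have hm : a ∈ s(a, b) := Sym2.mem_mk_left a b
      have h0 := Sym2.other_spec' hm
      have : Sym2.Mem.other' hm = b := by
        exact Sym2.congr_right.1 h0
      simp [s, this]
    have h1 := hc1 (a, s(a, b)) (by rw [hsa]; simp [hab.ne'])
    rw [hsa] at h1
    by_cases hca : c (a, s(a, b))
    · exact ⟨a, Sym2.mem_mk_left a b, Finset.mem_filter.2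
        ⟨(hI _ _).2 ⟨he, Sym2.mem_mk_left a b⟩, hca⟩⟩
    · exact ⟨b, Sym2.mem_mk_right a b, Finset.mem_filter.2
        ⟨(hI _ _).2 ⟨he, Sym2.mem_mk_right a b⟩, h1.2 hca⟩⟩
end

section
/- Every connected 4-regular finite simple graph equipped with a rotation system admits an orientation of its edges such that every vertex has out-degree exactly 2 and the two outgoing edges at each vertex are consecutive at that vertex. -/
open SimpleGraph

theorem aux_color {H : Type*} (α β : H → H) (ha : ∀ x, α (α x) = x) (hb : ∀ x, β (β x) = x)
    (ha' : ∀ x, α x ≠ x) (hb' : ∀ x, β x ≠ x) :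
    ∃ c : H → Prop, (∀ x, c (α x) ↔ ¬ c x) ∧ (∀ x, c (β x) ↔ ¬ c x) := by
  classical
  let A : Equiv.Perm H := ⟨α, α, ha, ha⟩
  let B : Equiv.Perm H := ⟨β, β, hb, hb⟩
  let σ : Equiv.Perm H := A * B
  have hA : ∀ x, A x = α x := fun _ => rfl
  have hB : ∀ x, B x = β x := fun _ => rfl
  have hAA : A * A = 1 := by ext x; exact ha x
  have hBB : B * B = 1 := by ext x; exact hb x
  have hAi : A⁻¹ = A := inv_eq_of_mul_eq_one_left hAA
  have hBi : B⁻¹ = B := inv_eq_of_mul_eq_one_left hBB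
  have hconj : A * σ * A⁻¹ = σ⁻¹ := by
    simp only [σ, mul_inv_rev, hAi, hBi]
    rw [← mul_assoc, hAA, one_mul]
  have hc : ∀ k : ℤ, A * σ ^ k = σ ^ (-k) * A := by
    intro k
    have := conj_zpow (i := k) (a := A) (b := σ)
    rw [hconj] at this
    rw [zpow_neg, ← inv_zpow, this]; simp
  have hA' : ∀ x, A x ≠ x := ha'
  have hB' : ∀ x, B x ≠ x := hb'
  have hns : ∀ x, ¬ σ.SameCycle x (α x) := by
    rintro x ⟨k, hk⟩
    rw [← hA] at hk
    have h1 : (σ ^ k) x = A x := hk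
    rcases Int.even_or_odd' k with ⟨m, rfl | rfl⟩
    · apply hA' ((σ ^ m) x)
      have h2 : (A * σ ^ m) x = (σ ^ (-m) * A) x := by rw [hc]
      simp only [Equiv.Perm.mul_apply] at h2
      rw [h2, ← h1, ← Equiv.Perm.mul_apply, ← zpow_add]
      congr 2; ring
    · apply hB' ((σ ^ m) x)
      have h2 : (A * σ ^ (m+1)) x = (σ ^ (-(m+1)) * A) x := by rw [hc]
      have h3 : A * σ ^ (m+1) = B * σ ^ m := by
        rw [add_comm, zpow_add, zpow_one]
        simp only [σ]
        rw [← mul_assoc, ← mul_assoc A A B, hAA, one_mul]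
      rw [h3] at h2
      simp only [Equiv.Perm.mul_apply] at h2
      rw [h2, ← h1, ← Equiv.Perm.mul_apply, ← zpow_add]
      congr 2; ring
  let S := Equiv.Perm.SameCycle.setoid σ
  let q : H → Quotient S := fun x => Quotient.mk S x
  have hq : ∀ x y, q x = q y ↔ σ.SameCycle x y := fun x y => Quotient.eq
  have hqne : ∀ x, q x ≠ q (α x) := fun x h => hns x ((hq _ _).1 h)
  have h1 : ∀ x, q (α (β x)) = q x := fun x => (hq _ _).2 (by
    have : α (β x) = σ x := rfl
    rw [this, Equiv.Perm.sameCycle_apply_left])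
  have h2 : ∀ x, q (β x) = q (α x) := fun x => by
    have := h1 (β x)
    rw [hb] at this
    exact this.symm
  refine ⟨fun x => WellOrderingRel (q x) (q (α x)), ?_, ?_⟩
  · intro x
    simp only [ha]
    rcases trichotomous_of WellOrderingRel (q x) (q (α x)) with h | h | h
    · exact ⟨fun h' => (asymm h h').elim, fun h' => (h' h).elim⟩
    · exact (hqne x h).elim
    · exact ⟨fun _ h'' => asymm h h'', fun _ => h⟩
  · intro x
    simp only [h1, h2]
    rcases trichotomous_of WellOrderingRel (q x) (q (α x)) with h | h | h
    · exact ⟨fun h' => (asymm h h').elim, fun h' => (h' h).elim⟩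
    · exact (hqne x h).elim
    · exact ⟨fun _ h'' => asymm h h'', fun _ => h⟩

theorem aux_cycle {X : Type*} [Finite X] (r : Equiv.Perm X) (I : Set X) (hI : I.ncard = 4)
    (hmem : ∀ x ∈ I, r x ∈ I)
    (hcyc : ∀ e ∈ I, ∀ e' ∈ I, ∃ n : ℕ, (r ^ n) e = e') (e : X) (he : e ∈ I) :
    r (r (r (r e))) = e ∧ r (r e) ≠ e ∧ r e ≠ e ∧
      ∀ x ∈ I, x = e ∨ x = r e ∨ x = r (r e) ∨ x = r (r (r e)) := by
  classical
  have hit : ∀ n : ℕ, (r ^ n) e = r^[n] e := fun n => by rw [Equiv.Perm.iterate_eq_pow]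
  set p := Function.minimalPeriod r e with hp
  have hmemn : ∀ n : ℕ, r^[n] e ∈ I := by
    intro n
    induction n with
    | zero => exact he
    | succ n ih => rw [Function.iterate_succ_apply']; exact hmem _ ih
  have hpos : 0 < p := by
    apply Function.minimalPeriod_pos_of_mem_periodicPts
    refine ⟨orderOf r, orderOf_pos r, ?_⟩
    unfold Function.IsPeriodicPt Function.IsFixedPt
    rw [← hit, pow_orderOf_eq_one]; rfl
  have hIeq : I = (fun n => r^[n] e) '' Set.Iio p := by
    ext x
    constructor
    · intro hx
      obtain ⟨n, hn⟩ := hcyc e he x hx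
      refine ⟨n % p, Nat.mod_lt _ hpos, ?_⟩
      simp only
      rw [Function.iterate_mod_minimalPeriod_eq, ← hit, hn]
    · rintro ⟨n, -, rfl⟩
      exact hmemn n
  have hinj : Set.InjOn (fun n => r^[n] e) (Set.Iio p) :=
    Function.iterate_injOn_Iio_minimalPeriod
  have hp4 : p = 4 := by
    rw [hIeq, hinj.ncard_image] at hI
    simpa using hI
  rw [hp4] at hinj hIeq
  refine ⟨?_, ?_, ?_, ?_⟩
  · have := Function.iterate_minimalPeriod (f := r) (x := e)
    rw [← hp, hp4] at this
    exact this
  · intro h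
    have := @hinj 2 (by simp) 0 (by simp) h
    omega
  · intro h
    have := @hinj 1 (by simp) 0 (by simp) h
    omega
  · intro x hx
    rw [hIeq] at hx
    obtain ⟨n, hn, rfl⟩ := hx
    have : n < 4 := hn
    interval_cases n <;> simp

/-- Every connected 4-regular finite simple graph with a rotation system admits an
orientation (given by a choice of tail for each edge) in which every vertex has
out-degree exactly 2 and the two outgoing edges at each vertex are consecutive. -/
theorem orientation_outdeg_two_consecutive {V : Type*} [Fintype V] (G : SimpleGraph V)
    (hconn : G.Connected) (hreg : ∀ v, (G.neighborSet v).ncard = 4)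
    (ρ : RotationSystem G) :
    ∃ tail : Sym2 V → V,
      (∀ e ∈ G.edgeSet, tail e ∈ e) ∧
      (∀ v : V, ({e ∈ G.edgeSet | tail e = v} : Set (Sym2 V)).ncard = 2) ∧
      (∀ v : V, ∀ e ∈ G.edgeSet, ∀ e' ∈ G.edgeSet,
        tail e = v → tail e' = v → e ≠ e' → ρ.Consecutive v e e') := by
  classical
  have hmem : ∀ v, ∀ e ∈ G.incidenceSet v, ρ.rot v e ∈ G.incidenceSet v := by
    intro v e he
    by_contra h
    have := ρ.fixes v _ h
    rw [(ρ.rot v).injective this] at h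
    exact h he
  have hcard : ∀ v, (G.incidenceSet v).ncard = 4 := by
    intro v
    rw [← hreg v]
    exact Nat.card_congr (G.incidenceSetEquivNeighborSet v)
  have hcy := fun v e he => aux_cycle (ρ.rot v) (G.incidenceSet v) (hcard v) (hmem v)
    (ρ.cyclic v) e he
  let H := {p : V × Sym2 V // p.2 ∈ G.incidenceSet p.1}
  let α : H → H := fun p => ⟨(Sym2.Mem.other p.2.2, p.1.2), p.2.1, Sym2.other_mem p.2.2⟩
  let β : H → H := fun p => ⟨(p.1.1, ρ.rot p.1.1 (ρ.rot p.1.1 p.1.2)), hmem _ _ (hmem _ _ p.2)⟩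
  obtain ⟨c, hca, hcb⟩ := aux_color α β
    (by
      rintro ⟨⟨v, e⟩, h⟩
      refine Subtype.ext (Prod.ext ?_ rfl)
      exact Sym2.other_invol _ _)
    (by
      rintro ⟨⟨v, e⟩, h⟩
      refine Subtype.ext (Prod.ext rfl ?_)
      exact (hcy v e h).1)
    (by
      rintro ⟨⟨v, e⟩, h⟩ h'
      replace h' : Sym2.Mem.other h.2 = v := congrArg (fun p : H => p.1.1) h'
      have := Sym2.other_spec h.2
      rw [h'] at this
      have h1 := h.1
      rw [← this] at h1
      exact G.loopless.irrefl _ h1)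
    (by
      rintro ⟨⟨v, e⟩, h⟩ h'
      replace h' : ρ.rot v (ρ.rot v e) = e := congrArg (fun p : H => p.1.2) h'
      exact (hcy v e h).2.1 h')
  let P : V → Sym2 V → Prop := fun v e => ∃ h : e ∈ G.incidenceSet v, c ⟨(v, e), h⟩
  have hP2 : ∀ v, ∀ e ∈ G.incidenceSet v, (P v (ρ.rot v (ρ.rot v e)) ↔ ¬ P v e) := by
    intro v e he
    have := hcb ⟨(v, e), he⟩
    simp only [P, he, hmem v _ (hmem v _ he), exists_true_left]
    exact this
  have hPu : ∀ e ∈ G.edgeSet, ∃ v, ∀ w, P w e ↔ w = v := by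
    intro e
    induction e with | _ a b => ?_
    intro he
    have hne : a ≠ b := G.ne_of_adj he
    have hA : s(a, b) ∈ G.incidenceSet a := ⟨he, by simp⟩
    have hB : s(a, b) ∈ G.incidenceSet b := ⟨he, by simp⟩
    have h1 : P b s(a, b) ↔ ¬ P a s(a, b) := by
      have := hca ⟨(a, s(a, b)), hA⟩
      have h2 : α ⟨(a, s(a, b)), hA⟩ = ⟨(b, s(a, b)), hB⟩ := by
        refine Subtype.ext (Prod.ext ?_ rfl)
        have := Sym2.other_spec hA.2
        exact Sym2.congr_right.1 this
      rw [h2] at this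
      simp only [P, hA, hB, exists_true_left]
      exact this
    have h3 : ∀ w, P w s(a, b) → w = a ∨ w = b := by
      rintro w ⟨h, -⟩
      simpa using h.2
    by_cases ha : P a s(a, b)
    · refine ⟨a, fun w => ⟨fun hw => ?_, fun hw => hw ▸ ha⟩⟩
      rcases h3 w hw with h | h
      · exact h
      · subst h; exact absurd ha (h1.1 hw)
    · refine ⟨b, fun w => ⟨fun hw => ?_, fun hw => hw ▸ h1.2 ha⟩⟩
      rcases h3 w hw with h | h
      · subst h; exact absurd hw ha
      · exact h
  have : Nonempty V := hconn.nonempty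
  have hex : ∀ e : Sym2 V, ∃ v, e ∈ G.edgeSet → ∀ w, P w e ↔ w = v := by
    intro e
    by_cases he : e ∈ G.edgeSet
    · obtain ⟨v, hv⟩ := hPu e he
      exact ⟨v, fun _ => hv⟩
    · exact ⟨Classical.arbitrary V, fun h => absurd h he⟩
  choose tail htail using hex
  have hset : ∀ v, ∃ x ∈ G.incidenceSet v, ∀ e, (e ∈ G.edgeSet ∧ tail e = v) ↔
      (e = x ∨ e = ρ.rot v x) := by
    intro v
    have hset1 : ∀ e, (e ∈ G.edgeSet ∧ tail e = v) ↔ P v e := by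
      intro e
      constructor
      · rintro ⟨he, h⟩
        exact (htail e he v).2 h.symm
      · intro h
        obtain ⟨h1, -⟩ := id h
        exact ⟨h1.1, ((htail e h1.1 v).1 h).symm⟩
    have hx : ∃ x ∈ G.incidenceSet v, P v x ∧ P v (ρ.rot v x) := by
      obtain ⟨e, he⟩ : (G.incidenceSet v).Nonempty := by
        apply Set.nonempty_of_ncard_ne_zero
        rw [hcard]; norm_num
      have he1 := hmem v _ he
      have he2 := hmem v _ he1
      have he3 := hmem v _ he2
      have q0 := hP2 v _ he
      have q1 := hP2 v _ he1
      have q2 := hP2 v _ he2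
      have q4 := (hcy v e he).1
      by_cases p0 : P v e <;> by_cases p1 : P v (ρ.rot v e)
      · exact ⟨_, he, p0, p1⟩
      · exact ⟨_, he3, q1.2 p1, by rw [q4]; exact p0⟩
      · exact ⟨_, he1, p1, q0.2 p0⟩
      · exact ⟨_, he2, q0.2 p0, q1.2 p1⟩
    obtain ⟨x, hxI, hx0, hx1⟩ := hx
    refine ⟨x, hxI, fun e => ?_⟩
    rw [hset1]
    constructor
    · intro h
      obtain ⟨hI, -⟩ := id h
      rcases (hcy v x hxI).2.2.2 e hI with h' | h' | h' | h'
      · exact Or.inl h'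
      · exact Or.inr h'
      · rw [h'] at h
        exact absurd hx0 ((hP2 v _ hxI).1 h)
      · rw [h'] at h
        exact absurd hx1 ((hP2 v _ (hmem v _ hxI)).1 h)
    · rintro (rfl | rfl)
      · exact hx0
      · exact hx1
  refine ⟨tail, ?_, ?_, ?_⟩
  · intro e he
    obtain ⟨h, -⟩ := (htail e he (tail e)).2 rfl
    exact h.2
  · intro v
    obtain ⟨x, hxI, hx⟩ := hset v
    have : ({e ∈ G.edgeSet | tail e = v} : Set (Sym2 V)) = {x, ρ.rot v x} := by
      ext e
      simpa using hx e
    rw [this]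
    exact Set.ncard_pair (hcy v x hxI).2.2.1.symm
  · intro v e he e' he' ht ht' hne
    obtain ⟨x, hxI, hx⟩ := hset v
    have hI := hmem v x hxI
    rcases (hx e).1 ⟨he, ht⟩ with h | h <;> rcases (hx e').1 ⟨he', ht'⟩ with h' | h'
    · exact absurd (h.trans h'.symm) hne
    · subst h; subst h'; exact ⟨hne, hxI, hI, Or.inl rfl⟩
    · subst h; subst h'; exact ⟨hne, hI, hxI, Or.inr rfl⟩
    · exact absurd (h.trans h'.symm) hne
end

section
/- For every even integer Δ > 0 and every integer a ≥ Δ/2 − ⌊Δ/6⌋, every finite simple graph of maximum degree at most Δ, equipped with any rotation system, admits an a-angle cover. -/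
open SimpleGraph

/-- An angle at `v`: a set of at most two edges incident to `v` whose elements,
if there are two, are consecutive at `v`. -/
def RotationSystem.IsAngle {V : Type*} {G : SimpleGraph V} (ρ : RotationSystem G)
    (v : V) (ang : Finset (Sym2 V)) : Prop :=
  ang.card ≤ 2 ∧ (∀ e ∈ ang, e ∈ G.incidenceSet v) ∧
  (∀ e ∈ ang, ∀ e' ∈ ang, e ≠ e' → ρ.Consecutive v e e')

/-- An `a`-angle cover: each vertex gets at most `a` angles, and every edge lies
in some angle assigned to one of its endpoints. -/
def RotationSystem.IsMultiAngleCover {V : Type*} {G : SimpleGraph V} (ρ : RotationSystem G)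
    (a : ℕ) (B : V → Finset (Finset (Sym2 V))) : Prop :=
  (∀ v, (B v).card ≤ a) ∧
  (∀ v, ∀ ang ∈ B v, ρ.IsAngle v ang) ∧
  (∀ e ∈ G.edgeSet, ∃ v, v ∈ e ∧ ∃ ang ∈ B v, e ∈ ang)

theorem core_coloring {X : Type*} (α π : Equiv.Perm X) (hα : ∀ x, α (α x) = x)
    (hπ : ∀ x, π (π x) = x) (hα' : ∀ x, α x ≠ x) (hπ' : ∀ x, π x ≠ x) :
    ∃ c : X → Prop, (∀ x, c (α x) ↔ ¬ c x) ∧ (∀ x, c (π x) ↔ ¬ c x) := by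
  classical
  have hαα : α * α = 1 := by ext x; simp [hα]
  have hππ : π * π = 1 := by ext x; simp [hπ]
  have hαi : α⁻¹ = α := inv_eq_of_mul_eq_one_left hαα
  have hπi : π⁻¹ = π := inv_eq_of_mul_eq_one_left hππ
  set σ : Equiv.Perm X := α * π with hσ
  have hconj : α * σ * α⁻¹ = σ⁻¹ := by
    rw [hσ, mul_inv_rev, hαi, hπi, ← mul_assoc, hαα, one_mul]
  have hconjn : ∀ n : ℤ, ∀ x, α ((σ ^ n) x) = (σ ^ (-n)) (α x) := by
    intro n x
    have h : α * σ ^ n * α⁻¹ = σ ^ (-n) := by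
      rw [← conj_zpow, hconj, inv_zpow, zpow_neg]
    rw [← h]; simp
  have key : ∀ x, ¬ σ.SameCycle x (α x) := by
    rintro x ⟨n, hn⟩
    obtain ⟨m, rfl | rfl⟩ := Int.even_or_odd' n
    · apply hα' ((σ ^ m) x)
      rw [hconjn, ← hn, ← Equiv.Perm.mul_apply, ← zpow_add]
      congr 2; ring
    · apply hπ' ((σ ^ m) x)
      apply α.injective
      have h1 : α (π ((σ ^ m) x)) = (σ ^ (m + 1)) x := by
        rw [add_comm, zpow_add, zpow_one]; rfl
      rw [h1, hconjn, ← hn, ← Equiv.Perm.mul_apply, ← zpow_add]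
      congr 2; ring
  have hsc : ∀ x y, σ.SameCycle x y → σ.SameCycle (α x) (α y) := by
    rintro x y ⟨n, rfl⟩
    exact ⟨-n, (hconjn n x).symm⟩
  have hpi : ∀ x, σ.SameCycle (π x) (α x) := by
    intro x
    refine ⟨1, ?_⟩
    simp [hσ, hπ]
  let s : Setoid X := Equiv.Perm.SameCycle.setoid σ
  obtain ⟨lo⟩ : Nonempty (LinearOrder (Quotient s)) := ⟨IsWellOrder.linearOrder WellOrderingRel⟩
  have hne : ∀ x, (Quotient.mk s x) ≠ Quotient.mk s (α x) := fun x h => key x (Quotient.exact h)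
  have hA : ∀ x, (Quotient.mk s (α x) < Quotient.mk s (α (α x)) ↔
      ¬ Quotient.mk s x < Quotient.mk s (α x)) := by
    intro x
    rw [hα, not_lt]
    exact ⟨le_of_lt, fun h => lt_of_le_of_ne h (hne x).symm⟩
  refine ⟨fun x => Quotient.mk s x < Quotient.mk s (α x), hA, ?_⟩
  intro x
  have e1 : Quotient.mk s (π x) = Quotient.mk s (α x) := Quotient.sound (hpi x)
  have e2 : Quotient.mk s (α (π x)) = Quotient.mk s (α (α x)) := Quotient.sound (hsc _ _ (hpi x))
  simp only [e1, e2]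
  exact hA x

theorem ext_coloring {H K : Type*} (α : H → H) (hα : ∀ x, α (α x) = x) (hα' : ∀ x, α x ≠ x)
    (k : H → K) (hk : Function.Injective k) (p : K → K) (hp : ∀ x, p (p x) = x)
    (hp' : ∀ x, p x ≠ x) :
    ∃ c : H → Prop, (∀ x, c (α x) ↔ ¬ c x) ∧ (∀ x y, k y = p (k x) → ¬ (c x ∧ c y)) := by
  classical
  let a : K × Bool → K × Bool := fun z =>
    if h : ∃ x, k x = z.1 then (k (α h.choose), z.2) else (z.1, !z.2)
  have a1 : ∀ x b, a (k x, b) = (k (α x), b) := by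
    intro x b
    have h : ∃ y, k y = k x := ⟨x, rfl⟩
    have h2 : h.choose = x := hk h.choose_spec
    simp only [a]
    rw [dif_pos h, h2]
  have a2 : ∀ z b, (¬ ∃ x, k x = z) → a (z, b) = (z, !b) := by
    intro z b h
    simp only [a]
    rw [dif_neg h]
  have ha : Function.Involutive a := by
    rintro ⟨z, b⟩
    by_cases h : ∃ x, k x = z
    · obtain ⟨x, rfl⟩ := h
      rw [a1, a1, hα]
    · rw [a2 _ _ h, a2 _ _ h]; simp
  have ha' : ∀ z, a z ≠ z := by
    rintro ⟨z, b⟩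
    by_cases h : ∃ x, k x = z
    · obtain ⟨x, rfl⟩ := h
      rw [a1]
      intro h
      exact hα' x (hk (congrArg Prod.fst h))
    · rw [a2 _ _ h]; simp
  let q : K × Bool → K × Bool := fun z => (p z.1, z.2)
  have hq : Function.Involutive q := by rintro ⟨z, b⟩; simp [q, hp]
  have hq' : ∀ z, q z ≠ z := by
    rintro ⟨z, b⟩ h
    exact hp' z (congrArg Prod.fst h)
  obtain ⟨c, hc1, hc2⟩ := core_coloring (ha.toPerm a) (hq.toPerm q) ha hq ha' hq'
  refine ⟨fun x => c (k x, true), ?_, ?_⟩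
  · intro x
    have := hc1 (k x, true)
    simp only [Function.Involutive.coe_toPerm, a1] at this
    exact this
  · rintro x y hxy ⟨h1, h2⟩
    have := hc2 (k x, true)
    simp only [Function.Involutive.coe_toPerm, q] at this
    rw [← hxy] at this
    exact this.1 h2 h1

/-- The pairing of positions: `0-2`, `1-4`, `3-5` in every block of six. -/
def pairPos (n : ℕ) : ℕ :=
  if n % 6 = 0 ∨ n % 6 = 3 then n + 2 else if n % 6 = 2 ∨ n % 6 = 5 then n - 2
  else if n % 6 = 1 then n + 3 else n - 3

theorem pairPos_pairPos (n : ℕ) : pairPos (pairPos n) = n := by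
  unfold pairPos
  split_ifs <;> omega

theorem pairPos_ne (n : ℕ) : pairPos n ≠ n := by
  unfold pairPos
  split_ifs <;> omega

theorem pairPos_three (q : ℕ) : pairPos (3 * q) = 3 * q + 2 := by
  unfold pairPos
  split_ifs <;> omega

theorem exists_starts (d : ℕ) (S : ℕ → Prop) (hS : ∀ n, S n → ¬ S (pairPos n)) :
    ∃ T : Finset ℕ, T.card ≤ (d + 2) / 3 ∧ ∀ n < d, S n → ∃ t ∈ T, n = t ∨ n = t + 1 := by
  classical
  let g : ℕ → ℕ := fun q => if S (3 * q) then 3 * q else if S (3 * q + 1) then 3 * q + 1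
    else 3 * q + 2
  refine ⟨(Finset.range ((d + 2) / 3)).image g, ?_, ?_⟩
  · exact Finset.card_image_le.trans (by simp)
  · intro n hn hSn
    refine ⟨g (n / 3), Finset.mem_image_of_mem _ (Finset.mem_range.2 (by omega)), ?_⟩
    have h3 := hS (3 * (n / 3))
    rw [pairPos_three] at h3
    simp only [g]
    have hc : n = 3 * (n / 3) ∨ n = 3 * (n / 3) + 1 ∨ n = 3 * (n / 3) + 2 := by omega
    split_ifs with h1 h2
    · rcases hc with h | h | h
      · exact Or.inl h
      · exact Or.inr h
      · exact absurd (h ▸ hSn) (h3 h1)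
    · rcases hc with h | h | h
      · exact absurd (h ▸ hSn) h1
      · exact Or.inl h
      · exact Or.inr h
    · rcases hc with h | h | h
      · exact absurd (h ▸ hSn) h1
      · exact absurd (h ▸ hSn) h2
      · exact Or.inl h

theorem exists_index {V : Type*} [Fintype V] {G : SimpleGraph V} (ρ : RotationSystem G) (v : V) :
    ∃ idx : Sym2 V → ℕ, (∀ e ∈ G.incidenceSet v, idx e < (G.neighborSet v).ncard) ∧
      (∀ e ∈ G.incidenceSet v, ∀ e' ∈ G.incidenceSet v, idx e = idx e' → e = e') ∧
      (∀ e ∈ G.incidenceSet v, ∀ e' ∈ G.incidenceSet v, idx e' = idx e + 1 → ρ.rot v e = e') := by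
  classical
  by_cases hne : (G.incidenceSet v).Nonempty
  swap
  · rw [Set.not_nonempty_iff_eq_empty] at hne
    simp [hne]
  obtain ⟨e0, he0⟩ := hne
  have hfin : (G.incidenceSet v).Finite := Set.toFinite _
  have hcard : hfin.toFinset.card = (G.neighborSet v).ncard := by
    rw [← Set.ncard_eq_toFinset_card _ hfin]
    exact Nat.card_congr (G.incidenceSetEquivNeighborSet v)
  have hmaps : ∀ e, ρ.rot v e ∈ G.incidenceSet v ↔ e ∈ G.incidenceSet v := by
    intro e
    constructor
    · intro h
      by_contra h'
      exact h' (ρ.fixes v e h' ▸ h)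
    · intro h
      by_contra h'
      have := (ρ.rot v).injective (ρ.fixes v _ h')
      exact h' (this.symm ▸ h)
  have hcyc : (ρ.rot v).IsCycleOn (hfin.toFinset : Set (Sym2 V)) := by
    rw [Set.Finite.coe_toFinset]
    refine ⟨(ρ.rot v).bijOn (fun e => hmaps e), ?_⟩
    intro e he e' he'
    obtain ⟨n, hn⟩ := ρ.cyclic v e he e' he'
    exact ⟨n, by simpa using hn⟩
  have hex : ∀ e : Sym2 V, ∃ n : ℕ, e ∈ G.incidenceSet v →
      n < (G.neighborSet v).ncard ∧ ((ρ.rot v) ^ n) e0 = e := by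
    intro e
    by_cases he : e ∈ G.incidenceSet v
    · obtain ⟨n, hn, h⟩ := hcyc.exists_pow_eq (hfin.mem_toFinset.2 he0) (hfin.mem_toFinset.2 he)
      exact ⟨n, fun _ => ⟨hcard ▸ hn, h⟩⟩
    · exact ⟨0, fun h => absurd h he⟩
  choose idx hidx using hex
  refine ⟨idx, fun e he => (hidx e he).1, ?_, ?_⟩
  · intro e he e' he' h
    rw [← (hidx e he).2, ← (hidx e' he').2, h]
  · intro e he e' he' h
    rw [← (hidx e' he').2, h, pow_succ', Equiv.Perm.mul_apply, (hidx e he).2]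

/-- For every even `Δ > 0` and every `a ≥ Δ/2 − ⌊Δ/6⌋`, every finite simple graph of
maximum degree at most `Δ`, with any rotation system, admits an `a`-angle cover. -/
theorem multiAngleCover_of_even_maxDegree {V : Type*} [Fintype V] (Δ a : ℕ)
    (hΔpos : 0 < Δ) (hΔeven : Even Δ) (ha : Δ / 2 - Δ / 6 ≤ a)
    (G : SimpleGraph V) (hdeg : ∀ v, (G.neighborSet v).ncard ≤ Δ)
    (ρ : RotationSystem G) :
    ∃ B : V → Finset (Finset (Sym2 V)), ρ.IsMultiAngleCover a B := by
  classical
  choose idx hlt hinj hsucc using fun v => exists_index ρ v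
  have hmem : ∀ d : G.Dart, d.edge ∈ G.incidenceSet d.fst := fun d =>
    ⟨d.edge_mem, Sym2.mem_mk_left _ _⟩
  obtain ⟨c, hc1, hc2⟩ := ext_coloring (H := G.Dart) (K := V × ℕ) (fun d => d.symm)
    (fun d => d.symm_symm) (fun d => d.symm_ne) (fun d => (d.fst, idx d.fst d.edge))
    (by
      intro d d' h
      obtain ⟨h1, h2⟩ := Prod.mk.inj h
      have h3 : d.edge = d'.edge := by
        apply hinj d.fst _ (hmem d) _ (h1 ▸ hmem d')
        rw [h2, h1]
      rcases (SimpleGraph.dart_edge_eq_iff d d').1 h3 with h | h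
      · exact h
      · exfalso
        rw [h] at h1
        exact d'.adj.ne h1.symm)
    (fun z => (z.1, pairPos z.2)) (fun z => by simp [pairPos_pairPos])
    (fun z h => pairPos_ne z.2 (congrArg Prod.snd h))
  have hT := fun v => exists_starts (G.neighborSet v).ncard
    (fun n => ∃ d : G.Dart, d.fst = v ∧ idx v d.edge = n ∧ c d) (by
      rintro n ⟨d, rfl, rfl, hcd⟩ ⟨d', h1, h2, hcd'⟩
      refine hc2 d d' ?_ ⟨hcd, hcd'⟩
      simp only [h1, h2])
  choose T hTcard hT using hT
  let ang : V → ℕ → Finset (Sym2 V) := fun v t =>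
    Finset.univ.filter (fun e => e ∈ G.incidenceSet v ∧ (idx v e = t ∨ idx v e = t + 1))
  have hang : ∀ v t e, e ∈ ang v t ↔
      e ∈ G.incidenceSet v ∧ (idx v e = t ∨ idx v e = t + 1) := by
    intro v t e; simp [ang]
  refine ⟨fun v => (T v).image (ang v), ?_, ?_, ?_⟩
  · intro v
    refine Finset.card_image_le.trans ((hTcard v).trans ?_)
    have := hdeg v
    obtain ⟨m, rfl⟩ := hΔeven
    omega
  · intro v A hA
    obtain ⟨t, ht, rfl⟩ := Finset.mem_image.1 hA
    refine ⟨?_, fun e he => ((hang v t e).1 he).1, ?_⟩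
    · have : (ang v t).card ≤ ({t, t + 1} : Finset ℕ).card := by
        apply Finset.card_le_card_of_injOn (idx v)
        · intro e he
          have := ((hang v t e).1 he).2
          simpa using this
        · intro e he e' he' h
          exact hinj v e ((hang v t e).1 he).1 e' ((hang v t e').1 he').1 h
      exact this.trans Finset.card_le_two
    · intro e he e' he' hne
      obtain ⟨h1, h2⟩ := (hang v t e).1 he
      obtain ⟨h1', h2'⟩ := (hang v t e').1 he'
      refine ⟨hne, h1, h1', ?_⟩
      have hne' : idx v e ≠ idx v e' := fun h => hne (hinj v e h1 e' h1' h)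
      have hc : idx v e' = idx v e + 1 ∨ idx v e = idx v e' + 1 := by omega
      rcases hc with h | h
      · exact Or.inl (hsucc v e h1 e' h1' h)
      · exact Or.inr (hsucc v e' h1' e h1 h)
  · have main : ∀ d : G.Dart, c d → ∃ v, v ∈ d.edge ∧ ∃ A ∈ (T v).image (ang v), d.edge ∈ A := by
      intro d hd
      refine ⟨d.fst, Sym2.mem_mk_left _ _, ?_⟩
      obtain ⟨t, ht, h⟩ := hT d.fst (idx d.fst d.edge) (hlt _ _ (hmem d)) ⟨d, rfl, rfl, hd⟩
      exact ⟨ang d.fst t, Finset.mem_image_of_mem _ ht, (hang _ _ _).2 ⟨hmem d, h⟩⟩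
    intro e he
    induction e using Sym2.ind with
    | _ u w =>
      let d : G.Dart := ⟨(u, w), he⟩
      by_cases hd : c d
      · exact main d hd
      · have h := main d.symm ((hc1 d).2 hd)
        rw [SimpleGraph.Dart.edge_symm] at h
        exact h
end

section
/- Let G = (V,E) be a finite simple graph with a rotation system that admits an a-angle cover for some positive integer a. Then for every subset S ⊆ V, the number of edges of G with both endpoints in S is at most 2a·|S|. In particular, a graph admitting an angle cover (the case a = 1) has low edge density: every k-vertex subgraph has at most 2k edges. -/
open SimpleGraph

/-- If a finite simple graph with a rotation system admits an `a`-angle cover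
(`a ≥ 1`), then every subset `S` of vertices spans at most `2·a·|S|` edges. -/
theorem edge_density_of_multiAngleCover {V : Type*} [Fintype V] (G : SimpleGraph V)
    (ρ : RotationSystem G) (a : ℕ) (ha : 0 < a)
    (B : V → Finset (Finset (Sym2 V))) (hB : ρ.IsMultiAngleCover a B)
    (S : Finset V) :
    ({e ∈ G.edgeSet | ∀ v ∈ e, v ∈ S} : Set (Sym2 V)).ncard ≤ 2 * a * S.card := by
  classical
  obtain ⟨h1, h2, h3⟩ := hB
  have hsub : ({e ∈ G.edgeSet | ∀ v ∈ e, v ∈ S} : Set (Sym2 V)) ⊆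
      ((S.biUnion fun v => (B v).biUnion id : Finset (Sym2 V)) : Set (Sym2 V)) := by
    rintro e ⟨he, hS⟩
    obtain ⟨v, hv, ang, hang, hea⟩ := h3 e he
    simp only [Finset.mem_coe, Finset.mem_biUnion, id]
    exact ⟨v, hS v hv, ang, hang, hea⟩
  refine (Set.ncard_le_ncard hsub (Finset.finite_toSet _)).trans ?_
  rw [Set.ncard_coe_finset, mul_comm (2 * a)]
  refine Finset.card_biUnion_le_card_mul _ _ _ fun v _ => ?_
  refine (Finset.card_biUnion_le_card_mul _ _ 2 fun x hx => (h2 v x hx).1).trans ?_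
  have := h1 v
  omega
end

section
/- There exists a finite simple graph G = (V,E) with a rotation system such that every vertex of G has degree 3, 4, or 5, G admits an orientation of its edges in which every vertex has out-degree exactly 2 and the resulting directed graph is strongly connected, and yet (G, rotation system) admits no angle cover. -/
open SimpleGraph

namespace AngleEx

def adjB (u v : Fin 6) : Bool := decide (u ≠ v) && (decide (u < 3) || decide (v < 3))

def G : SimpleGraph (Fin 6) where
  Adj u v := adjB u v = true
  symm := ⟨by decide⟩
  loopless := ⟨by decide⟩

instance : DecidableRel G.Adj := fun u v => inferInstanceAs (Decidable (adjB u v = true))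

/-- neighbours in cyclic order -/
def nbs : Fin 6 → List (Fin 6)
  | 0 => [3, 1, 4, 5, 2]
  | 1 => [3, 0, 5, 4, 2]
  | 2 => [3, 0, 4, 5, 1]
  | _ => [0, 1, 2]

def lst (v : Fin 6) : List (Sym2 (Fin 6)) := (nbs v).map (fun w => s(v, w))

theorem mem_inc (v : Fin 6) (e : Sym2 (Fin 6)) : e ∈ G.incidenceSet v ↔ e ∈ lst v := by
  constructor
  · rintro ⟨h, hv⟩
    obtain ⟨w, rfl⟩ := hv
    have h : adjB v w = true := h
    revert v w
    decide
  · intro h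
    obtain ⟨w, hw, rfl⟩ := List.mem_map.1 h
    have : adjB v w = true := by
      clear h
      revert v w
      decide
    exact ⟨this, Sym2.mem_mk_left v w⟩

def rho : RotationSystem G where
  rot v := (lst v).formPerm
  fixes v e h := List.formPerm_apply_of_notMem (fun h' => h ((mem_inc v e).2 h'))
  cyclic v e he e' he' := by
    rw [mem_inc] at he he'
    have : ∀ v, ∀ e ∈ lst v, ∀ e' ∈ lst v, ∃ n : Fin 5, ((lst v).formPerm ^ (n : ℕ)) e = e' := by
      decide
    obtain ⟨n, hn⟩ := this v e he e' he'
    exact ⟨n, hn⟩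

def outs : Fin 6 → Fin 6 × Fin 6
  | 0 => (1, 3)
  | 1 => (2, 4)
  | 2 => (0, 5)
  | 3 => (1, 2)
  | 4 => (2, 0)
  | 5 => (0, 1)

def isOut (u w : Fin 6) : Bool := decide (w = (outs u).1) || decide (w = (outs u).2)

def tl (e : Sym2 (Fin 6)) : Fin 6 :=
  if e = s(0, 1) ∨ e = s(0, 3) then 0
  else if e = s(1, 2) ∨ e = s(1, 4) then 1
  else if e = s(2, 0) ∨ e = s(2, 5) then 2
  else if e = s(3, 1) ∨ e = s(3, 2) then 3
  else if e = s(4, 2) ∨ e = s(4, 0) then 4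
  else 5

theorem tl_spec : ∀ u w, adjB u w = true → (tl s(u, w) = u ∨ tl s(u, w) = w) := by decide

theorem tl_out (v : Fin 6) :
    ({e ∈ G.edgeSet | tl e = v} : Set (Sym2 (Fin 6))) = {s(v, (outs v).1), s(v, (outs v).2)} := by
  ext e
  induction e with
  | _ a b =>
    simp only [Set.mem_ofPred_eq, SimpleGraph.mem_edgeSet, Set.mem_insert_iff,
      Set.mem_singleton_iff]
    change (adjB a b = true ∧ _) ↔ _
    revert v a b
    decide

def nx (v : Fin 6) : Fin 6 := ![3, 4, 5, 1, 2, 0] v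

theorem no_cover (A : Fin 6 → Finset (Sym2 (Fin 6))) (h : rho.IsAngleCover A) : False := by
  obtain ⟨h1, h2, h3, h4⟩ := h
  have edge : ∀ u w, adjB u w = true → s(u, w) ∈ A u ∨ s(u, w) ∈ A w := by
    intro u w huw
    obtain ⟨v, hv, hA⟩ := h4 s(u, w) huw
    rcases Sym2.mem_iff.1 hv with rfl | rfl
    · exact Or.inl hA
    · exact Or.inr hA
  have non : ∀ v e e', e ≠ e' → (lst v).formPerm e ≠ e' → (lst v).formPerm e' ≠ e →
      e ∈ A v → e' ∈ A v → False := by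
    intro v e e' hne ha hb he he'
    rcases (h3 v e he e' he' hne).2.2.2 with h | h
    · exact ha h
    · exact hb h
  have three : ∀ v e e' e'', e ≠ e' → e ≠ e'' → e' ≠ e'' →
      e ∈ A v → e' ∈ A v → e'' ∈ A v → False := by
    intro v e e' e'' a b c he he' he''
    have := Finset.two_lt_card.2 ⟨e, he, e', he', e'', he'', a, b, c⟩
    have := h1 v
    omega
  have e01 := edge 0 1 (by decide)
  have e02 := edge 0 2 (by decide)
  have e03 := edge 0 3 (by decide)
  have e04 := edge 0 4 (by decide)
  have e05 := edge 0 5 (by decide)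
  have e12 := edge 1 2 (by decide)
  have e13 := edge 1 3 (by decide)
  have e14 := edge 1 4 (by decide)
  have e15 := edge 1 5 (by decide)
  have e23 := edge 2 3 (by decide)
  have e24 := edge 2 4 (by decide)
  have e25 := edge 2 5 (by decide)
  have n002 := non 0 s(0, 3) s(0, 4) (by decide) (by decide) (by decide)
  have n003 := non 0 s(0, 3) s(0, 5) (by decide) (by decide) (by decide)
  have n013 := non 0 s(0, 1) s(0, 5) (by decide) (by decide) (by decide)
  have n014 := non 0 s(0, 1) s(0, 2) (by decide) (by decide) (by decide)
  have n024 := non 0 s(0, 4) s(0, 2) (by decide) (by decide) (by decide)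
  have n102 := non 1 s(1, 3) s(1, 5) (by decide) (by decide) (by decide)
  have n103 := non 1 s(1, 3) s(1, 4) (by decide) (by decide) (by decide)
  have n113 := non 1 s(0, 1) s(1, 4) (by decide) (by decide) (by decide)
  have n114 := non 1 s(0, 1) s(1, 2) (by decide) (by decide) (by decide)
  have n124 := non 1 s(1, 5) s(1, 2) (by decide) (by decide) (by decide)
  have n202 := non 2 s(2, 3) s(2, 4) (by decide) (by decide) (by decide)
  have n203 := non 2 s(2, 3) s(2, 5) (by decide) (by decide) (by decide)
  have n213 := non 2 s(0, 2) s(2, 5) (by decide) (by decide) (by decide)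
  have n214 := non 2 s(0, 2) s(1, 2) (by decide) (by decide) (by decide)
  have n224 := non 2 s(2, 4) s(1, 2) (by decide) (by decide) (by decide)
  have t3 := three 3 s(0, 3) s(1, 3) s(2, 3) (by decide) (by decide) (by decide)
  have t4 := three 4 s(0, 4) s(1, 4) s(2, 4) (by decide) (by decide) (by decide)
  have t5 := three 5 s(0, 5) s(1, 5) s(2, 5) (by decide) (by decide) (by decide)
  clear edge non three h1 h2 h3 h4
  grind

end AngleEx

/-- There is a finite simple graph with all vertex degrees in {3,4,5}, with a rotation
system, admitting an orientation with out-degree 2 at every vertex whose directed graph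
is strongly connected, but admitting no angle cover. -/
theorem exists_degrees_345_strongly_connected_orientation_no_angleCover :
    ∃ (V : Type) (_ : Fintype V) (G : SimpleGraph V) (ρ : RotationSystem G),
      (∀ v, (G.neighborSet v).ncard = 3 ∨ (G.neighborSet v).ncard = 4 ∨
        (G.neighborSet v).ncard = 5) ∧
      (∃ tail : Sym2 V → V,
        (∀ e ∈ G.edgeSet, tail e ∈ e) ∧
        (∀ v : V, ({e ∈ G.edgeSet | tail e = v} : Set (Sym2 V)).ncard = 2) ∧
        (∀ u w : V, Relation.ReflTransGen (fun p q => G.Adj p q ∧ tail s(p, q) = p) u w)) ∧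
      ¬∃ A : V → Finset (Sym2 V), ρ.IsAngleCover A := by
  refine ⟨Fin 6, inferInstance, AngleEx.G, AngleEx.rho, ?_, ⟨AngleEx.tl, ?_, ?_, ?_⟩, ?_⟩
  · intro v
    rw [Set.ncard_eq_toFinset_card']
    revert v
    decide
  · intro e he
    induction e with
    | _ a b =>
      rcases AngleEx.tl_spec a b he with h | h
      · rw [h]; exact Sym2.mem_mk_left a b
      · rw [h]; exact Sym2.mem_mk_right a b
  · intro v
    rw [AngleEx.tl_out]
    apply Set.ncard_pair
    revert v
    decide
  · have step : ∀ u, AngleEx.adjB u (AngleEx.nx u) = true ∧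
        AngleEx.tl s(u, AngleEx.nx u) = u := by decide
    have it : ∀ (n : ℕ) (u : Fin 6), Relation.ReflTransGen
        (fun p q => AngleEx.G.Adj p q ∧ AngleEx.tl s(p, q) = p) u (AngleEx.nx^[n] u) := by
      intro n
      induction n with
      | zero => intro u; exact Relation.ReflTransGen.refl
      | succ n ih => intro u; exact Relation.ReflTransGen.head (step u) (ih _)
    have ex : ∀ u w : Fin 6, ∃ n : Fin 6, AngleEx.nx^[(n : ℕ)] u = w := by decide
    intro u w
    obtain ⟨n, rfl⟩ := ex u w
    exact it n u
  · rintro ⟨A, hA⟩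
    exact AngleEx.no_cover A hA
end

section
/- There exists a finite simple graph G of maximum degree 5 together with two rotation systems σ and σ' on G such that (G, σ) admits an angle cover while (G, σ') admits no angle cover. -/
open SimpleGraph

namespace ACov

def nb : Fin 7 → List (Fin 7) := ![[1, 4], [4, 0, 6, 5, 2], [4, 1, 5], [5], [6, 2, 1, 5, 0], [3, 2, 4, 6, 1], [4, 5, 1]]

def nb' : Fin 7 → List (Fin 7) := ![[4, 1], [6, 2, 5, 0, 4], [4, 1, 5], [5], [0, 1, 2, 6, 5], [4, 3, 1, 6, 2], [1, 4, 5]]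

def G : SimpleGraph (Fin 7) where
  Adj v w := w ∈ nb v
  symm := ⟨by decide⟩
  loopless := ⟨by decide⟩

instance : DecidableRel G.Adj := fun v w => inferInstanceAs (Decidable (w ∈ nb v))

theorem mem_map_iff (l : Fin 7 → List (Fin 7)) (h : ∀ v w, w ∈ l v ↔ G.Adj v w) (v : Fin 7)
    (e : Sym2 (Fin 7)) : e ∈ (l v).map (fun w => s(v, w)) ↔ e ∈ G.incidenceSet v := by
  constructor
  · intro he
    obtain ⟨w, hw, rfl⟩ := List.mem_map.1 he
    exact ⟨(h v w).1 hw, Sym2.mem_mk_left v w⟩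
  · rintro ⟨he, hv⟩
    obtain ⟨w, rfl⟩ := hv
    exact List.mem_map.2 ⟨w, (h v w).2 he, rfl⟩

def mkRot (l : Fin 7 → List (Fin 7)) (h : ∀ v w, w ∈ l v ↔ G.Adj v w)
    (hn : ∀ v, ((l v).map (fun w => s(v, w))).Nodup) : RotationSystem G where
  rot v := ((l v).map (fun w => s(v, w))).formPerm
  fixes v e he := List.formPerm_apply_of_notMem (by rwa [mem_map_iff l h])
  cyclic v e he e' he' := by
    rw [← mem_map_iff l h] at he he'
    have hc := (hn v).isCycleOn_formPerm
    have hc' : (((l v).map (fun w => s(v, w))).formPerm).IsCycleOn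
      (((l v).map (fun w => s(v, w))).toFinset : Set (Sym2 (Fin 7))) := by
      simpa using hc
    obtain ⟨n, -, hx⟩ := hc'.exists_pow_eq (by simpa using he) (by simpa using he')
    exact ⟨n, hx⟩

def rs : RotationSystem G := mkRot nb (fun _ _ => Iff.rfl) (by decide)

def rs' : RotationSystem G := mkRot nb' (by decide) (by decide)

def cov : Fin 7 → Finset (Sym2 (Fin 7)) :=
  ![{s(0, 1), s(0, 4)}, {s(1, 2), s(1, 4)}, {s(2, 4), s(2, 5)}, {s(3, 5)}, {s(4, 1), s(4, 5)}, {s(5, 1), s(5, 6)}, {s(6, 1), s(6, 4)}]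

theorem rs_cov : rs.IsAngleCover cov := by
  have h2 : ∀ v, ∀ e ∈ cov v, e ∈ (nb v).map (fun w => s(v, w)) := by decide
  have h2' : ∀ v, ∀ e ∈ cov v, e ∈ G.incidenceSet v := fun v e he =>
    (mem_map_iff nb (fun _ _ => Iff.rfl) v e).1 (h2 v e he)
  refine ⟨by decide, h2', ?_, ?_⟩
  · have h3 : ∀ v, ∀ e ∈ cov v, ∀ e' ∈ cov v, e ≠ e' →
      (rs.rot v e = e' ∨ rs.rot v e' = e) := by decide
    intro v e he e' he' hne
    exact ⟨hne, h2' v e he, h2' v e' he', h3 v e he e' he' hne⟩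
  · have h4 : ∀ a b, G.Adj a b → s(a, b) ∈ cov a ∨ s(a, b) ∈ cov b := by decide
    intro e
    induction e using Sym2.ind with
    | _ a b =>
      intro he
      rcases h4 a b he with h | h
      · exact ⟨a, Sym2.mem_mk_left a b, h⟩
      · exact ⟨b, Sym2.mem_mk_right a b, h⟩

theorem rs'_no (A : Fin 7 → Finset (Sym2 (Fin 7))) : ¬ rs'.IsAngleCover A := by
  rintro ⟨hc, -, hcons, hcov⟩
  obtain ⟨c, hcd⟩ : ∃ c : Fin 7 → Fin 7 → Prop, ∀ a b, c a b ↔ s(a, b) ∈ A a :=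
    ⟨_, fun _ _ => Iff.rfl⟩
  have hE : ∀ a b, G.Adj a b → c a b ∨ c b a := by
    intro a b hab
    obtain ⟨v, hv, hm⟩ := hcov s(a, b) hab
    rcases Sym2.mem_iff.1 hv with rfl | rfl
    · exact Or.inl ((hcd _ _).2 hm)
    · exact Or.inr ((hcd _ _).2 (by rwa [Sym2.eq_swap]))
  have hN : ∀ v a b, s(v, a) ≠ s(v, b) → rs'.rot v s(v, a) ≠ s(v, b) →
      rs'.rot v s(v, b) ≠ s(v, a) → ¬ (c v a ∧ c v b) := by
    rintro v a b h0 h1 h2 ⟨ha, hb⟩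
    rcases (hcons v _ ((hcd _ _).1 ha) _ ((hcd _ _).1 hb) h0).2.2.2 with h | h
    · exact h1 h
    · exact h2 h
  have h3 : ∀ v a b d, s(v, a) ≠ s(v, b) → s(v, a) ≠ s(v, d) → s(v, b) ≠ s(v, d) →
      ¬ (c v a ∧ c v b ∧ c v d) := by
    rintro v a b d h0 h1 h2 ⟨ha, hb, hd⟩
    have : 2 < (A v).card := Finset.two_lt_card.2
      ⟨_, (hcd _ _).1 ha, _, (hcd _ _).1 hb, _, (hcd _ _).1 hd, h0, h1, h2⟩
    have := hc v
    omega
  have e01 := hE 0 1 (by decide)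
  have e04 := hE 0 4 (by decide)
  have e14 := hE 1 4 (by decide)
  have e16 := hE 1 6 (by decide)
  have e15 := hE 1 5 (by decide)
  have e12 := hE 1 2 (by decide)
  have e24 := hE 2 4 (by decide)
  have e25 := hE 2 5 (by decide)
  have e35 := hE 3 5 (by decide)
  have e46 := hE 4 6 (by decide)
  have e45 := hE 4 5 (by decide)
  have e56 := hE 5 6 (by decide)
  have n165 := hN 1 6 5 (by decide) (by decide) (by decide)
  have n120 := hN 1 2 0 (by decide) (by decide) (by decide)
  have n154 := hN 1 5 4 (by decide) (by decide) (by decide)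
  have n106 := hN 1 0 6 (by decide) (by decide) (by decide)
  have n142 := hN 1 4 2 (by decide) (by decide) (by decide)
  have t2 := h3 2 4 1 5 (by decide) (by decide) (by decide)
  have n402 := hN 4 0 2 (by decide) (by decide) (by decide)
  have n416 := hN 4 1 6 (by decide) (by decide) (by decide)
  have n425 := hN 4 2 5 (by decide) (by decide) (by decide)
  have n460 := hN 4 6 0 (by decide) (by decide) (by decide)
  have n451 := hN 4 5 1 (by decide) (by decide) (by decide)
  have n541 := hN 5 4 1 (by decide) (by decide) (by decide)
  have n536 := hN 5 3 6 (by decide) (by decide) (by decide)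
  have n512 := hN 5 1 2 (by decide) (by decide) (by decide)
  have n564 := hN 5 6 4 (by decide) (by decide) (by decide)
  have n523 := hN 5 2 3 (by decide) (by decide) (by decide)
  have t6 := h3 6 1 4 5 (by decide) (by decide) (by decide)
  clear hE hN h3 hcd hcov hcons hc
  grind

theorem deg (v : Fin 7) : (G.neighborSet v).ncard = G.degree v := by
  rw [Set.ncard_eq_toFinset_card', Set.toFinset_card, G.card_neighborSet_eq_degree]

end ACov

/-- There is a finite simple graph of maximum degree 5 with two rotation systems, one
admitting an angle cover and the other admitting none. -/
theorem exists_graph_two_rotation_systems :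
    ∃ (V : Type) (_ : Fintype V) (G : SimpleGraph V)
      (σ σ' : RotationSystem G),
      (∀ v, (G.neighborSet v).ncard ≤ 5) ∧
      (∃ v, (G.neighborSet v).ncard = 5) ∧
      (∃ A : V → Finset (Sym2 V), σ.IsAngleCover A) ∧
      ¬∃ A : V → Finset (Sym2 V), σ'.IsAngleCover A := by
  refine ⟨Fin 7, inferInstance, ACov.G, ACov.rs, ACov.rs', ?_, ⟨1, ?_⟩,
    ⟨ACov.cov, ACov.rs_cov⟩, fun ⟨A, h⟩ => ACov.rs'_no A h⟩
  · simp only [ACov.deg]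
    decide
  · rw [ACov.deg]
    decide
end

section
/- There exists a Laman graph G = (V,E) (i.e., |V| ≥ 2, |E| = 2|V| − 3, and for every S ⊆ V with |S| ≥ 2, the number of edges with both endpoints in S is at most 2|S| − 3) together with a rotation system on G such that (G, rotation system) admits no angle cover. -/
open SimpleGraph

namespace AC

/-- neighbours in cyclic order -/
def nb : Fin 9 → List (Fin 9)
  | 0 => [1, 4, 2, 5, 3, 6]
  | 1 => [0, 4, 2, 7, 3, 8]
  | 2 => [0, 5, 1, 7]
  | 3 => [0, 6, 1, 8]
  | 4 => [0, 1]
  | 5 => [0, 2]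
  | 6 => [0, 3]
  | 7 => [1, 2]
  | 8 => [1, 3]

def G : SimpleGraph (Fin 9) where
  Adj a b := b ∈ nb a
  symm := ⟨by decide⟩
  loopless := ⟨by decide⟩

instance : DecidableRel G.Adj := fun a b => inferInstanceAs (Decidable (b ∈ nb a))

def inc (v : Fin 9) : List (Sym2 (Fin 9)) := (nb v).map (fun b => s(v, b))

theorem mem_inc (v : Fin 9) (e : Sym2 (Fin 9)) : e ∈ G.incidenceSet v ↔ e ∈ inc v := by
  induction e with
  | _ a b =>
    rw [SimpleGraph.mk'_mem_incidenceSet_iff]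
    change (b ∈ nb a ∧ _) ↔ _
    revert v a b
    decide +kernel

theorem inc_nodup (v : Fin 9) : (inc v).Nodup := by
  revert v; decide +kernel

def R : RotationSystem G where
  rot v := (inc v).formPerm
  fixes v e h := List.formPerm_apply_of_notMem (by rwa [mem_inc] at h)
  cyclic v e h e' h' := by
    rw [mem_inc] at h h'
    exact ((inc_nodup v).isCycleOn_formPerm.2 h h').exists_nat_pow_eq

def old : Finset (Sym2 (Fin 9)) := {s(0,1), s(0,2), s(0,3), s(1,2), s(1,3)}

def edges : List (Fin 9 × Fin 9) :=
  [(0,1), (0,2), (0,3), (1,2), (1,3), (0,4), (1,4), (0,5), (2,5), (0,6), (3,6), (1,7), (2,7),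
    (1,8), (3,8)]

def E : Finset (Sym2 (Fin 9)) := (edges.map (fun p => s(p.1, p.2))).toFinset

theorem mem_E (e : Sym2 (Fin 9)) : e ∈ G.edgeSet ↔ e ∈ E := by
  induction e with
  | _ a b =>
    change b ∈ nb a ↔ _
    revert a b
    decide +kernel

theorem laman (S : Finset (Fin 9)) : 2 ≤ S.card →
    (edges.filter (fun p => p.1 ∈ S ∧ p.2 ∈ S)).length ≤ 2 * S.card - 3 := by
  revert S
  decide +kernel

theorem old_sep : ∀ v : Fin 9, ∀ e ∈ old, ∀ e' ∈ old, e ≠ e' →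
    (inc v).formPerm e ≠ e' := by
  decide +kernel

theorem old_lt : ∀ v : Fin 9, ∀ e ∈ old, v ∈ e → v ∈ ({0, 1, 2, 3} : Finset (Fin 9)) := by
  decide +kernel

theorem no_cover (A : Fin 9 → Finset (Sym2 (Fin 9))) (h : R.IsAngleCover A) : False := by
  obtain ⟨-, -, h3, h4⟩ := h
  have hE : ∀ e ∈ old, e ∈ G.edgeSet := by
    intro e he
    rw [mem_E]
    revert e
    decide +kernel
  choose! f hf using h4
  obtain ⟨e, he, e', he', hne, hfe⟩ := Finset.exists_ne_map_eq_of_card_lt_of_maps_to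
    (s := old) (t := ({0, 1, 2, 3} : Finset (Fin 9))) (f := f) (by decide +kernel)
    (fun e he => old_lt _ e he (hf e (hE e he)).1)
  have h1 := (hf e (hE e he)).2
  have h2 := (hf e' (hE e' he')).2
  rw [← hfe] at h2
  obtain ⟨-, -, -, h | h⟩ := h3 _ e h1 e' h2 hne
  · exact old_sep _ e he e' he' hne h
  · exact old_sep _ e' he' e he hne.symm h

theorem laman_set (S : Finset (Fin 9)) (hS : 2 ≤ S.card) :
    ({e ∈ G.edgeSet | ∀ v ∈ e, v ∈ S} : Set (Sym2 (Fin 9))).ncard ≤ 2 * S.card - 3 := by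
  refine le_trans ?_ (laman S hS)
  have : ({e ∈ G.edgeSet | ∀ v ∈ e, v ∈ S} : Set (Sym2 (Fin 9))) ⊆
      (((edges.filter (fun p => p.1 ∈ S ∧ p.2 ∈ S)).map (fun p => s(p.1, p.2))).toFinset :
        Finset (Sym2 (Fin 9))) := by
    rintro e ⟨he, hv⟩
    rw [mem_E, E, List.mem_toFinset, List.mem_map] at he
    obtain ⟨p, hp, rfl⟩ := he
    rw [Finset.mem_coe, List.mem_toFinset, List.mem_map]
    refine ⟨p, ?_, rfl⟩
    rw [List.mem_filter]
    exact ⟨hp, by simpa using hv⟩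
  refine (Set.ncard_le_ncard this (Finset.finite_toSet _)).trans ?_
  rw [Set.ncard_coe_finset]
  exact (List.toFinset_card_le _).trans (by rw [List.length_map])

theorem edge_card : G.edgeSet.ncard = 15 := by
  have : G.edgeSet = (E : Set (Sym2 (Fin 9))) := by
    ext e
    exact mem_E e
  rw [this, Set.ncard_coe_finset]
  decide +kernel

end AC

/-- There is a Laman graph with a rotation system that admits no angle cover. -/
theorem exists_laman_no_angleCover :
    ∃ (V : Type) (_ : Fintype V) (G : SimpleGraph V) (ρ : RotationSystem G),
      2 ≤ Fintype.card V ∧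
      G.edgeSet.ncard = 2 * Fintype.card V - 3 ∧
      (∀ S : Finset V, 2 ≤ S.card →
        ({e ∈ G.edgeSet | ∀ v ∈ e, v ∈ S} : Set (Sym2 V)).ncard ≤ 2 * S.card - 3) ∧
      ¬∃ A : V → Finset (Sym2 V), ρ.IsAngleCover A := by
  exact ⟨Fin 9, inferInstance, AC.G, AC.R, by simp, by simp [AC.edge_card],
    AC.laman_set, fun ⟨A, h⟩ => AC.no_cover A h⟩
end

section
/- Let G be a finite simple graph with a rotation system, and let uv and xy be two edges of G with {u,v} ∩ {x,y} = ∅. Let G' be obtained from G by deleting the edges uv and xy and adding a new vertex w adjacent to u, x, v, y, where the rotation at w is the cyclic order ⟨wu, wx, wv, wy⟩, and the rotation at each of u, v, x, y is obtained from its rotation in G by replacing the deleted edge (uv or xy, respectively) by the new edge to w in the same position; rotations at all other vertices are unchanged. Then (G, rotation system) admits an angle cover if and only if (G', rotation system) admits an angle cover. -/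
open SimpleGraph

set_option maxHeartbeats 4000000 in
/-- Planarizing a single crossing between edges `uv` and `xy` (with disjoint endpoint
sets) preserves the existence of an angle cover.  The planarized graph `G'` lives on
`Option V`, with `none` playing the role of the new vertex `w`; its adjacency and
rotation system are characterized by the hypotheses. -/
theorem angleCover_iff_planarization {V : Type*} [Fintype V] [DecidableEq V]
    (G : SimpleGraph V) (ρ : RotationSystem G) (u v x y : V)
    (huv : G.Adj u v) (hxy : G.Adj x y)
    (hdisj : ({u, v} ∩ {x, y} : Set V) = ∅)
    (G' : SimpleGraph (Option V))
    (hG' : ∀ p q : Option V, G'.Adj p q ↔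
      ((∃ a b : V, p = some a ∧ q = some b ∧ G.Adj a b ∧
          s(a, b) ≠ s(u, v) ∧ s(a, b) ≠ s(x, y)) ∨
       (p = none ∧ (q = some u ∨ q = some v ∨ q = some x ∨ q = some y)) ∨
       (q = none ∧ (p = some u ∨ p = some v ∨ p = some x ∨ p = some y))))
    (ρ' : RotationSystem G')
    -- `φ z` renames an edge of `G` incident to `z` to the corresponding edge of `G'`:
    -- the deleted edge (`uv` or `xy`) incident to `z` becomes the new edge `z w`.
    (φ : V → Sym2 V → Sym2 (Option V))
    (hφ : ∀ z : V, ∀ e : Sym2 V,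
      φ z e = if e = s(u, v) ∨ e = s(x, y) then s(some z, none) else e.map some)
    -- the rotation at each original vertex is unchanged up to renaming
    (hrot : ∀ z : V, ∀ e ∈ G.incidenceSet z,
      ρ'.rot (some z) (φ z e) = φ z (ρ.rot z e))
    -- the rotation at the new vertex `w` is the cyclic order ⟨wu, wx, wv, wy⟩
    (hrotw : ρ'.rot none s(some u, none) = s(some x, none) ∧
             ρ'.rot none s(some x, none) = s(some v, none) ∧
             ρ'.rot none s(some v, none) = s(some y, none) ∧
             ρ'.rot none s(some y, none) = s(some u, none)) :
    (∃ A : V → Finset (Sym2 V), ρ.IsAngleCover A) ↔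
      (∃ A' : Option V → Finset (Sym2 (Option V)), ρ'.IsAngleCover A') := by
  classical
  have hd : u ≠ x ∧ u ≠ y ∧ v ≠ x ∧ v ≠ y := by
    refine ⟨?_, ?_, ?_, ?_⟩ <;> intro h <;> subst h
    · exact Set.eq_empty_iff_forall_notMem.1 hdisj u (by simp)
    · exact Set.eq_empty_iff_forall_notMem.1 hdisj u (by simp)
    · exact Set.eq_empty_iff_forall_notMem.1 hdisj v (by simp)
    · exact Set.eq_empty_iff_forall_notMem.1 hdisj v (by simp)
  obtain ⟨hux, huy, hvx, hvy⟩ := hd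
  have huv' := huv.ne
  have hxy' := hxy.ne
  -- w-edges
  have hw : ∀ z, (z = u ∨ z = v ∨ z = x ∨ z = y) → G'.Adj (some z) none := by
    intro z hz
    rw [hG']
    right; right
    simpa using hz
  have hwE : ∀ z, (z = u ∨ z = v ∨ z = x ∨ z = y) →
      s(some z, none) ∈ G'.incidenceSet none := by
    intro z hz
    exact ⟨hw z hz, by simp⟩
  have hnone : ∀ e : Sym2 V, none ∉ e.map some := by
    intro e h
    simp [Sym2.mem_map] at h
  have hmapE : ∀ e ∈ G.edgeSet, ¬ (e = s(u, v) ∨ e = s(x, y)) → e.map some ∈ G'.edgeSet := by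
    intro e
    induction e with
    | _ a b =>
      intro he hn
      push Not at hn
      rw [Sym2.map_mk, SimpleGraph.mem_edgeSet, hG']
      exact Or.inl ⟨a, b, rfl, rfl, he, hn.1, hn.2⟩
  have hφinc : ∀ z, ∀ e ∈ G.incidenceSet z, φ z e ∈ G'.incidenceSet (some z) := by
    intro z e he
    rw [hφ]
    split_ifs with h
    · refine ⟨hw z ?_, by simp⟩
      have := he.2
      rcases h with rfl | rfl <;> simp at this <;> tauto
    · exact ⟨hmapE e he.1 h, Sym2.mem_map.2 ⟨z, he.2, rfl⟩⟩
  have hφinj : ∀ z, ∀ e ∈ G.incidenceSet z, ∀ e' ∈ G.incidenceSet z, φ z e = φ z e' → e = e' := by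
    intro z e he e' he' h
    rw [hφ, hφ] at h
    have h1 := he.2
    have h2 := he'.2
    split_ifs at h with ha hb hb
    · rcases ha with rfl | rfl <;> rcases hb with rfl | rfl <;> simp at h1 h2 ⊢ <;> grind
    · exact absurd (h ▸ by simp) (hnone e')
    · exact absurd (h ▸ by simp) (hnone e)
    · exact Sym2.map.injective (Option.some_injective V) h
  have hrotinc : ∀ z, ∀ e ∈ G.incidenceSet z, ρ.rot z e ∈ G.incidenceSet z := by
    intro z e he
    by_contra hc
    have := (ρ.rot z).injective (ρ.fixes z _ hc)
    rw [this] at hc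
    exact hc he
  have hcons : ∀ z, ∀ e ∈ G.incidenceSet z, ∀ e' ∈ G.incidenceSet z,
      (ρ'.Consecutive (some z) (φ z e) (φ z e') ↔ ρ.Consecutive z e e') := by
    intro z e he e' he'
    have key : ∀ a ∈ G.incidenceSet z, ∀ b ∈ G.incidenceSet z,
        (ρ'.rot (some z) (φ z a) = φ z b ↔ ρ.rot z a = b) := by
      intro a ha b hb
      rw [hrot z a ha]
      exact ⟨hφinj z _ (hrotinc z a ha) _ hb, fun h => by rw [h]⟩
    unfold RotationSystem.Consecutive
    rw [key e he e' he', key e' he' e he]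
    have h1 := hφinc z e he
    have h2 := hφinc z e' he'
    have h3 : φ z e = φ z e' ↔ e = e' := ⟨hφinj z e he e' he', fun h => by rw [h]⟩
    simp only [ne_eq, h3, he, he', h1, h2]
  obtain ⟨r1, r2, r3, r4⟩ := hrotw
  have hsp1 : ∀ z, φ z s(u, v) = s(some z, none) := by intro z; rw [hφ]; simp
  have hsp2 : ∀ z, φ z s(x, y) = s(some z, none) := by intro z; rw [hφ]; simp
  constructor
  · rintro ⟨A, hc, hi, hA, hcov⟩
    have pick : ∀ a b : V, G.Adj a b → ∃ p, (p = a ∨ p = b) ∧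
        ∀ r, (r = a ∨ r = b) → r = p ∨ s(a, b) ∈ A r := by
      intro a b hab
      obtain ⟨t, ht, htA⟩ := hcov s(a, b) hab
      rcases Sym2.mem_iff.1 ht with rfl | rfl
      · exact ⟨b, Or.inr rfl, by rintro r (rfl | rfl) <;> simp [htA]⟩
      · exact ⟨a, Or.inl rfl, by rintro r (rfl | rfl) <;> simp [htA]⟩
    obtain ⟨p, hp, hpA⟩ := pick u v huv
    obtain ⟨q, hq, hqA⟩ := pick x y hxy
    have hpq : ρ'.Consecutive none s(some p, none) s(some q, none) := by
      refine ⟨?_, hwE p (by tauto), hwE q (by tauto), ?_⟩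
      · intro h
        have : p = q := by simpa using h
        grind
      · rcases hp with rfl | rfl <;> rcases hq with rfl | rfl <;> tauto
    have hqp : ρ'.Consecutive none s(some q, none) s(some p, none) :=
      ⟨hpq.1.symm, hpq.2.2.1, hpq.2.1, hpq.2.2.2.symm⟩
    let A' : Option V → Finset (Sym2 (Option V)) := fun o =>
      match o with
      | none => {s(some p, none), s(some q, none)}
      | some z => (A z).image (φ z)
    have hwcov : ∀ z, (z = u ∨ z = v ∨ z = x ∨ z = y) →
        ∃ t, t ∈ s(some z, none) ∧ s(some z, none) ∈ A' t := by
      intro z hz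
      have : z = p ∨ z = q ∨ s(u, v) ∈ A z ∨ s(x, y) ∈ A z := by
        have h1 := hpA z
        have h2 := hqA z
        tauto
      rcases this with rfl | rfl | h | h
      · exact ⟨none, by simp, by simp [A']⟩
      · exact ⟨none, by simp, by simp [A']⟩
      · exact ⟨some z, by simp, Finset.mem_image.2 ⟨_, h, hsp1 z⟩⟩
      · exact ⟨some z, by simp, Finset.mem_image.2 ⟨_, h, hsp2 z⟩⟩
    refine ⟨A', ?_, ?_, ?_, ?_⟩
    · rintro (_ | z)
      · exact Finset.card_le_two
      · exact Finset.card_image_le.trans (hc z)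
    · rintro (_ | z) e he
      · simp only [A', Finset.mem_insert, Finset.mem_singleton] at he
        rcases he with rfl | rfl
        · exact hpq.2.1
        · exact hpq.2.2.1
      · obtain ⟨e, hf, rfl⟩ := Finset.mem_image.1 he
        exact hφinc z e (hi z e hf)
    · rintro (_ | z) e he e' he' hne
      · simp only [A', Finset.mem_insert, Finset.mem_singleton] at he he'
        rcases he with rfl | rfl <;> rcases he' with rfl | rfl
        · exact absurd rfl hne
        · exact hpq
        · exact hqp
        · exact absurd rfl hne
      · obtain ⟨e, hf, rfl⟩ := Finset.mem_image.1 he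
        obtain ⟨e', hf', rfl⟩ := Finset.mem_image.1 he'
        rw [hcons z e (hi z e hf) e' (hi z e' hf')]
        exact hA z e hf e' hf' (fun h => hne (by rw [h]))
    · intro e
      induction e with
      | _ a b =>
        intro he
        rw [SimpleGraph.mem_edgeSet, hG'] at he
        rcases he with ⟨a, b, rfl, rfl, hab, h1, h2⟩ | ⟨rfl, h⟩ | ⟨rfl, h⟩
        · obtain ⟨t, ht, htA⟩ := hcov s(a, b) hab
          refine ⟨some t, by simpa using ht, Finset.mem_image.2 ⟨_, htA, ?_⟩⟩
          rw [hφ, if_neg (by tauto)]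
          rfl
        · rw [Sym2.eq_swap]
          rcases h with rfl | rfl | rfl | rfl <;> exact hwcov _ (by simp)
        · rcases h with rfl | rfl | rfl | rfl <;> exact hwcov _ (by simp)
  · rintro ⟨A', hc, hi, hA, hcov⟩
    let A : V → Finset (Sym2 V) := fun z =>
      Finset.univ.filter (fun e => e ∈ G.incidenceSet z ∧ φ z e ∈ A' (some z))
    have hmem : ∀ z e, e ∈ A z ↔ e ∈ G.incidenceSet z ∧ φ z e ∈ A' (some z) := by
      intro z e; simp [A]
    have hside : ∀ z, (z = u ∨ z = v ∨ z = x ∨ z = y) →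
        s(some z, none) ∈ A' none ∨ s(some z, none) ∈ A' (some z) := by
      intro z hz
      obtain ⟨t, ht, htA⟩ := hcov s(some z, none) (hw z hz)
      rcases Sym2.mem_iff.1 ht with rfl | rfl
      · exact Or.inr htA
      · exact Or.inl htA
    refine ⟨A, ?_, ?_, ?_, ?_⟩
    · intro z
      refine le_trans (Finset.card_le_card_of_injOn (φ z) ?_ ?_) (hc (some z))
      · intro e he
        exact ((hmem z e).1 he).2
      · intro e he e' he' h
        exact hφinj z e ((hmem z e).1 he).1 e' ((hmem z e').1 he').1 h
    · intro z e he
      exact ((hmem z e).1 he).1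
    · intro z e he e' he' hne
      rw [hmem] at he he'
      rw [← hcons z e he.1 e' he'.1]
      exact hA _ _ he.2 _ he'.2 (fun h => hne (hφinj z e he.1 e' he'.1 h))
    · intro e he
      by_cases hs : e = s(u, v) ∨ e = s(x, y)
      · rcases hs with rfl | rfl
        · have : s(some u, none) ∈ A' (some u) ∨ s(some v, none) ∈ A' (some v) := by
            by_contra hcon
            push Not at hcon
            have h1 := (hside u (by simp)).resolve_right hcon.1
            have h2 := (hside v (by simp)).resolve_right hcon.2
            have h3 := hA none _ h1 _ h2 (by simpa using huv')
            have h4 := h3.2.2.2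
            rw [r1, r3] at h4
            simp at h4
            grind
          rcases this with h | h
          · exact ⟨u, by simp, (hmem _ _).2 ⟨⟨he, by simp⟩, by rwa [hsp1]⟩⟩
          · exact ⟨v, by simp, (hmem _ _).2 ⟨⟨he, by simp⟩, by rwa [hsp1]⟩⟩
        · have : s(some x, none) ∈ A' (some x) ∨ s(some y, none) ∈ A' (some y) := by
            by_contra hcon
            push Not at hcon
            have h1 := (hside x (by simp)).resolve_right hcon.1
            have h2 := (hside y (by simp)).resolve_right hcon.2
            have h3 := hA none _ h1 _ h2 (by simpa using hxy')
            have h4 := h3.2.2.2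
            rw [r2, r4] at h4
            simp at h4
            grind
          rcases this with h | h
          · exact ⟨x, by simp, (hmem _ _).2 ⟨⟨he, by simp⟩, by rwa [hsp2]⟩⟩
          · exact ⟨y, by simp, (hmem _ _).2 ⟨⟨he, by simp⟩, by rwa [hsp2]⟩⟩
      · obtain ⟨t, ht, htA⟩ := hcov _ (hmapE e he hs)
        obtain ⟨z, hz, rfl⟩ := Sym2.mem_map.1 ht
        refine ⟨z, hz, (hmem z e).2 ⟨⟨he, hz⟩, ?_⟩⟩
        rw [hφ, if_neg hs]
        exact htA
end

section
/- Let G = (V,E) be a finite simple graph and let G_mat be the bipartite graph with vertex parts E and V × {1,2}, where e ∈ E is adjacent to (v,i) if and only if v is an endpoint of e. Then G_mat has a matching saturating E (i.e., of size |E|) if and only if G has low edge density, that is, for every S ⊆ V the number of edges of G with both endpoints in S is at most 2|S|. -/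
open SimpleGraph

/-- The auxiliary bipartite graph `G_mat` (characterized by `hmat`) has a matching
saturating the edge part if and only if `G` has low edge density: every vertex subset
`S` spans at most `2|S|` edges. -/
theorem matching_saturating_edges_iff_low_density {V : Type*} [Fintype V]
    (G : SimpleGraph V)
    (Gmat : SimpleGraph (↥G.edgeSet ⊕ V × Fin 2))
    (hmat : ∀ p q : ↥G.edgeSet ⊕ V × Fin 2, Gmat.Adj p q ↔
      ∃ (e : ↥G.edgeSet) (w : V) (i : Fin 2),
        (p = Sum.inl e ∧ q = Sum.inr (w, i) ∨ p = Sum.inr (w, i) ∧ q = Sum.inl e) ∧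
        w ∈ (e : Sym2 V)) :
    (∃ M : Gmat.Subgraph, M.IsMatching ∧
        ∀ e : ↥G.edgeSet, (Sum.inl e : ↥G.edgeSet ⊕ V × Fin 2) ∈ M.verts) ↔
      (∀ S : Finset V, ({e ∈ G.edgeSet | ∀ v ∈ e, v ∈ S} : Set (Sym2 V)).ncard ≤ 2 * S.card) := by
  classical
  constructor
  · rintro ⟨M, hM, hv⟩ S
    have key : ∀ e : ↥G.edgeSet, ∃ x : V × Fin 2, M.Adj (Sum.inl e) (Sum.inr x) ∧
        x.1 ∈ (e : Sym2 V) := by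
      intro e
      obtain ⟨q, hq, -⟩ := hM (hv e)
      obtain ⟨e', w, i, h | h, hw⟩ := (hmat _ _).1 hq.adj_sub
      · obtain ⟨h1, rfl⟩ := h
        obtain rfl := Sum.inl_injective h1
        exact ⟨(w, i), hq, hw⟩
      · exact absurd h.1 (by simp)
    choose f hf hfe using key
    have hinj : Function.Injective f := by
      intro a b hab
      have h1 := (hf a).symm
      have h2 := (hf b).symm
      rw [← hab] at h2
      exact Sum.inl_injective ((hM (M.edge_vert h1)).unique h1 h2)
    let T : Set (Sym2 V) := {e ∈ G.edgeSet | ∀ v ∈ e, v ∈ S}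
    have hc : T.ncard ≤ ((S ×ˢ (Finset.univ : Finset (Fin 2)) : Finset (V × Fin 2)) :
        Set (V × Fin 2)).ncard := by
      refine Set.ncard_le_ncard_of_injOn
        (fun e => if h : e ∈ G.edgeSet then f ⟨e, h⟩ else
          (e.out.1, 0)) ?_ ?_ (Finset.finite_toSet _)
      · rintro e ⟨he, hS⟩
        simp only [he, dite_true, Finset.coe_product, Finset.coe_univ, Set.mem_prod]
        exact ⟨hS _ (hfe ⟨e, he⟩), Set.mem_univ _⟩
      · rintro a ⟨ha, -⟩ b ⟨hb, -⟩ hab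
        simp only [ha, hb, dite_true] at hab
        exact congrArg Subtype.val (hinj hab)
    rw [Set.ncard_coe_finset, Finset.card_product, Finset.card_univ, Fintype.card_fin,
      mul_comm] at hc
    exact hc
  · intro hd
    obtain ⟨f, hinj, hf⟩ := (Fintype.all_card_le_filter_rel_iff_exists_injective
      (fun (e : ↥G.edgeSet) (x : V × Fin 2) => x.1 ∈ (e : Sym2 V))).1 (by
        intro A
        let S : Finset V := {v | ∃ a ∈ A, v ∈ (a : Sym2 V)}
        have h1 : (Finset.univ.filter (fun x : V × Fin 2 => ∃ a ∈ A, x.1 ∈ (a : Sym2 V)))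
            = S ×ˢ (Finset.univ : Finset (Fin 2)) := by
          ext x
          simp [S]
        have h2 : A.card ≤ ({e ∈ G.edgeSet | ∀ v ∈ e, v ∈ S} : Set (Sym2 V)).ncard := by
          rw [← Set.ncard_coe_finset A]
          refine Set.ncard_le_ncard_of_injOn Subtype.val ?_
            Subtype.val_injective.injOn (Set.toFinite _)
          intro a ha
          refine ⟨a.2, fun v hv => ?_⟩
          simp only [S, Finset.mem_filter, Finset.mem_univ, true_and]
          exact ⟨a, ha, hv⟩
        rw [h1, Finset.card_product, Finset.card_univ, Fintype.card_fin, mul_comm]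
        exact h2.trans (hd S))
    refine ⟨{ verts := {p | ∃ e, p = Sum.inl e ∨ p = Sum.inr (f e)}
              Adj := fun p q => ∃ e, (p = Sum.inl e ∧ q = Sum.inr (f e)) ∨
                (p = Sum.inr (f e) ∧ q = Sum.inl e)
              adj_sub := ?_
              edge_vert := ?_
              symm := ?_ }, ?_, ?_⟩
    · rintro p q ⟨e, h⟩
      exact (hmat p q).2 ⟨e, (f e).1, (f e).2, h, hf e⟩
    · rintro p q ⟨e, h⟩
      exact ⟨e, h.imp And.left And.left⟩
    · constructor
      rintro p q ⟨e, h⟩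
      exact ⟨e, h.symm.imp And.symm And.symm⟩
    · rintro p ⟨e, rfl | rfl⟩
      · refine ⟨Sum.inr (f e), ⟨e, Or.inl ⟨rfl, rfl⟩⟩, ?_⟩
        rintro q ⟨e', ⟨h1, rfl⟩ | ⟨h1, rfl⟩⟩
        · rw [Sum.inl_injective h1]
        · exact absurd h1 (by simp)
      · refine ⟨Sum.inl e, ⟨e, Or.inr ⟨rfl, rfl⟩⟩, ?_⟩
        rintro q ⟨e', ⟨h1, rfl⟩ | ⟨h1, rfl⟩⟩
        · exact absurd h1 (by simp)
        · rw [hinj (Sum.inr_injective h1)]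
    · exact fun e => ⟨e, Or.inl rfl⟩
end

section
/- Let G = (V,E) be a finite simple graph with a rotation system, and let G_med be its medial graph: the simple graph with vertex set E in which distinct edges e, e' of G are adjacent if and only if there is a vertex v of G incident to both e and e' such that e and e' are consecutive at v. Then the minimum total number of angles in an angle allocation of (G, rotation system) equals |E| − ν(G_med), where ν(G_med) is the maximum size of a matching in G_med. -/
open SimpleGraph

theorem aux_matching_card {W : Type*} [Finite W] {H : SimpleGraph W} (M : H.Subgraph)
    (hM : M.IsMatching) : M.verts.ncard = 2 * M.edgeSet.ncard := by
  classical
  have := Fintype.ofFinite W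
  have h1 : M.verts.toFinset = M.edgeSet.toFinset.biUnion (fun e => e.toFinset) := by
    ext w
    simp only [Set.mem_toFinset, Finset.mem_biUnion, Sym2.mem_toFinset]
    constructor
    · intro hw
      obtain ⟨x, hx, _⟩ := hM hw
      exact ⟨s(w, x), hx, by simp⟩
    · rintro ⟨e, he, hw⟩
      exact M.mem_verts_of_mem_edge he hw
  rw [Set.ncard_eq_toFinset_card', Set.ncard_eq_toFinset_card', h1, Finset.card_biUnion]
  · rw [Finset.sum_const_nat (m := 2), mul_comm]
    intro e he
    rw [Set.mem_toFinset] at he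
    exact Sym2.card_toFinset_of_not_isDiag e (H.not_isDiag_of_mem_edgeSet (M.edgeSet_subset he))
  · intro e he e' he' hne
    rw [Finset.mem_coe, Set.mem_toFinset] at he he'
    rw [Function.onFun, Finset.disjoint_left]
    intro w hw hw'
    rw [Sym2.mem_toFinset] at hw hw'
    obtain ⟨x, rfl⟩ := hw
    obtain ⟨y, rfl⟩ := hw'
    have hxy : x = y := hM.eq_of_adj_left he he'
    exact hne (by rw [hxy])

theorem aux_lower {V : Type*} [Fintype V]
    (G : SimpleGraph V) (ρ : RotationSystem G)
    (Gmed : SimpleGraph ↥G.edgeSet)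
    (hmed : ∀ e e' : ↥G.edgeSet, Gmed.Adj e e' ↔
      ∃ v : V, ρ.Consecutive v (e : Sym2 V) (e' : Sym2 V))
    (α : V → Finset (Finset (Sym2 V)))
    (h1 : ∀ v, ∀ ang ∈ α v, ang.Nonempty ∧ ρ.IsAngle v ang)
    (h2 : ∀ e ∈ G.edgeSet, ∃ u, u ∈ e ∧ ∃ ang ∈ α u, e ∈ ang) :
    ∃ M : Gmed.Subgraph, M.IsMatching ∧
      G.edgeSet.ncard ≤ M.edgeSet.ncard + ∑ v : V, (α v).card := by
  classical
  have h3 : ∀ e : G.edgeSet, ∃ p : (_ : V) × Finset (Sym2 V),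
      p ∈ Finset.univ.sigma α ∧ (e : Sym2 V) ∈ p.2 := by
    intro e
    obtain ⟨u, _, a, ha, hea⟩ := h2 e e.2
    exact ⟨⟨u, a⟩, by simpa using ha, hea⟩
  choose f hf hef using h3
  have hang : ∀ e, ρ.IsAngle (f e).1 (f e).2 := fun e =>
    (h1 _ _ (by simpa using hf e)).2
  have hfib : ∀ a b c : G.edgeSet, f a = f b → f a = f c → a ≠ b → a ≠ c → b = c := by
    intro a b c hab hac nab nac
    by_contra nbc
    have hb := hef b
    have hc := hef c
    rw [← hab] at hb
    rw [← hac] at hc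
    have hs : ({(a : Sym2 V), (b : Sym2 V), (c : Sym2 V)} : Finset (Sym2 V)) ⊆ (f a).2 := by
      intro x hx
      simp only [Finset.mem_insert, Finset.mem_singleton] at hx
      rcases hx with rfl | rfl | rfl
      · exact hef a
      · exact hb
      · exact hc
    have := Finset.card_le_card hs
    rw [Finset.card_eq_three.2 ⟨(a : Sym2 V), b, c, fun h => nab (Subtype.ext h),
      fun h => nac (Subtype.ext h), fun h => nbc (Subtype.ext h), rfl⟩] at this
    have := (hang a).1
    omega
  let M : Gmed.Subgraph :=
    { verts := {e | ∃ e', e ≠ e' ∧ f e = f e'}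
      Adj := fun e e' => e ≠ e' ∧ f e = f e'
      adj_sub := by
        rintro a b ⟨nab, hab⟩
        rw [hmed]
        have hb := hef b
        rw [← hab] at hb
        exact ⟨(f a).1, (hang a).2.2 a (hef a) b hb (fun h => nab (Subtype.ext h))⟩
      edge_vert := by
        rintro a b h
        exact ⟨b, h⟩
      symm := ⟨fun a b h => ⟨h.1.symm, h.2.symm⟩⟩ }
  have hM : M.IsMatching := by
    rintro a ⟨b, nab, hab⟩
    refine ⟨b, ⟨nab, hab⟩, ?_⟩
    rintro c ⟨nac, hac⟩
    exact (hfib a b c hab hac nab nac).symm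
  refine ⟨M, hM, ?_⟩
  have hc := aux_matching_card M hM
  have hE : G.edgeSet.ncard = M.verts.ncard + (M.verts)ᶜ.ncard := by
    rw [Set.ncard_add_ncard_compl, Nat.card_coe_set_eq]
  rw [Set.ncard_eq_toFinset_card' M.verts] at hE hc
  rw [Set.ncard_eq_toFinset_card' (M.verts)ᶜ] at hE
  have e1 : M.verts.toFinset.card ≤ 2 * (M.verts.toFinset.image f).card := by
    apply Finset.card_le_mul_card_image
    intro p _
    by_contra hlt
    rw [not_le, Finset.two_lt_card] at hlt
    obtain ⟨a, ha, b, hb, c, hc, nab, nac, nbc⟩ := hlt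
    rw [Finset.mem_filter] at ha hb hc
    exact nbc (hfib a b c (ha.2.trans hb.2.symm) (ha.2.trans hc.2.symm) nab nac)
  have e2 : ((M.verts)ᶜ.toFinset.image f).card = (M.verts)ᶜ.toFinset.card := by
    apply Finset.card_image_of_injOn
    intro a ha b hb hab
    by_contra nab
    simp only [Set.coe_toFinset] at ha
    exact ha ⟨b, nab, hab⟩
  have e3 : Disjoint (M.verts.toFinset.image f) ((M.verts)ᶜ.toFinset.image f) := by
    rw [Finset.disjoint_left]
    intro p hp hp'
    rw [Finset.mem_image] at hp hp'
    obtain ⟨a, ha, rfl⟩ := hp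
    obtain ⟨b, hb, hab⟩ := hp'
    rw [Set.mem_toFinset] at ha hb
    refine hb ⟨a, ?_, hab⟩
    rintro rfl
    exact hb ha
  have e4 : (M.verts.toFinset.image f ∪ (M.verts)ᶜ.toFinset.image f).card
      ≤ (Finset.univ.sigma α).card := by
    apply Finset.card_le_card
    intro p hp
    rw [Finset.mem_union, Finset.mem_image, Finset.mem_image] at hp
    rcases hp with ⟨a, _, rfl⟩ | ⟨a, _, rfl⟩ <;> exact hf a
  rw [Finset.card_union_of_disjoint e3, Finset.card_sigma] at e4
  omega

theorem aux_upper {V : Type*} [Fintype V]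
    (G : SimpleGraph V) (ρ : RotationSystem G)
    (Gmed : SimpleGraph ↥G.edgeSet)
    (hmed : ∀ e e' : ↥G.edgeSet, Gmed.Adj e e' ↔
      ∃ v : V, ρ.Consecutive v (e : Sym2 V) (e' : Sym2 V))
    (M : Gmed.Subgraph) (hM : M.IsMatching) :
    ∃ α : V → Finset (Finset (Sym2 V)),
      (∀ v, ∀ ang ∈ α v, ang.Nonempty ∧ ρ.IsAngle v ang) ∧
      (∀ e ∈ G.edgeSet, ∃ u, u ∈ e ∧ ∃ ang ∈ α u, e ∈ ang) ∧
      ∑ v : V, (α v).card + M.edgeSet.ncard ≤ G.edgeSet.ncard := by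
  classical
  let F : Finset (Finset (Sym2 V)) :=
    M.edgeSet.toFinset.image (fun p => (p.map (Subtype.val)).toFinset) ∪
      (M.verts)ᶜ.toFinset.image (fun e : G.edgeSet => {(e : Sym2 V)})
  have hF : ∀ a ∈ F, ∃ v, a.Nonempty ∧ ρ.IsAngle v a := by
    intro a ha
    rw [Finset.mem_union, Finset.mem_image, Finset.mem_image] at ha
    rcases ha with ⟨p, hp, rfl⟩ | ⟨e, _, rfl⟩
    · rw [Set.mem_toFinset] at hp
      induction p using Sym2.ind with
      | _ x y =>
        obtain ⟨v, hv⟩ := (hmed x y).1 (M.adj_sub hp)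
        rw [Sym2.map_mk, Sym2.toFinset_mk_eq]
        refine ⟨v, by simp, Finset.card_le_two, ?_, ?_⟩
        · intro e he
          simp only [Finset.mem_insert, Finset.mem_singleton] at he
          rcases he with rfl | rfl
          · exact hv.2.1
          · exact hv.2.2.1
        · intro e he e' he' hne
          simp only [Finset.mem_insert, Finset.mem_singleton] at he he'
          have hv' : ρ.Consecutive v y x := ⟨hv.1.symm, hv.2.2.1, hv.2.1, hv.2.2.2.symm⟩
          rcases he with rfl | rfl <;> rcases he' with rfl | rfl
          · exact absurd rfl hne
          · exact hv
          · exact hv'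
          · exact absurd rfl hne
    · obtain ⟨v, hv⟩ : ∃ v, v ∈ (e : Sym2 V) := ⟨_, Sym2.out_fst_mem _⟩
      refine ⟨v, by simp, by simp, ?_, ?_⟩
      · intro x hx
        rw [Finset.mem_singleton] at hx
        subst hx
        exact ⟨e.2, hv⟩
      · intro x hx y hy hne
        rw [Finset.mem_singleton] at hx hy
        exact absurd (hx.trans hy.symm) hne
  have hcov : ∀ e ∈ G.edgeSet, ∃ a ∈ F, e ∈ a := by
    intro e he
    by_cases hv : (⟨e, he⟩ : G.edgeSet) ∈ M.verts
    · obtain ⟨x, hx, _⟩ := hM hv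
      refine ⟨_, Finset.mem_union_left _ (Finset.mem_image_of_mem _
        (Set.mem_toFinset.2 (show s(⟨e, he⟩, x) ∈ M.edgeSet from hx))), ?_⟩
      simp
    · refine ⟨_, Finset.mem_union_right _ (Finset.mem_image_of_mem _
        (Set.mem_toFinset.2 (show (⟨e, he⟩ : G.edgeSet) ∈ (M.verts)ᶜ from hv))), ?_⟩
      simp
  have hcard : F.card + M.edgeSet.ncard ≤ G.edgeSet.ncard := by
    have hc := aux_matching_card M hM
    have hE : G.edgeSet.ncard = M.verts.ncard + (M.verts)ᶜ.ncard := by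
      rw [Set.ncard_add_ncard_compl, Nat.card_coe_set_eq]
    rw [Set.ncard_eq_toFinset_card' (M.verts)ᶜ] at hE
    rw [Set.ncard_eq_toFinset_card' M.edgeSet] at hc ⊢
    have : F.card ≤ M.edgeSet.toFinset.card + (M.verts)ᶜ.toFinset.card :=
      (Finset.card_union_le _ _).trans
        (Nat.add_le_add Finset.card_image_le Finset.card_image_le)
    omega
  rcases isEmpty_or_nonempty V with hV | hV
  · refine ⟨fun _ => ∅, fun v => isEmptyElim v, fun e _ => isEmptyElim (Quot.out e).1, ?_⟩
    simp only [Finset.univ_eq_empty, Finset.sum_empty]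
    omega
  choose! g hg using hF
  refine ⟨fun v => F.filter (fun a => g a = v), ?_, ?_, ?_⟩
  · intro v a ha
    rw [Finset.mem_filter] at ha
    rw [← ha.2]
    exact hg a ha.1
  · intro e he
    obtain ⟨a, ha, hea⟩ := hcov e he
    exact ⟨g a, ((hg a ha).2.2.1 e hea).2, a, Finset.mem_filter.2 ⟨ha, rfl⟩, hea⟩
  · rw [← Finset.card_eq_sum_card_fiberwise (fun a _ => Finset.mem_coe.2 (Finset.mem_univ (g a)))]
    exact hcard

/-- The minimum total number of angles in an angle allocation equals
`|E| − ν(G_med)`, where `G_med` is the medial graph (characterized by `hmed`) and `ν`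
denotes the maximum size of a matching. -/
theorem min_angle_allocation_eq_edges_sub_max_matching {V : Type*} [Fintype V]
    (G : SimpleGraph V) (ρ : RotationSystem G)
    (Gmed : SimpleGraph ↥G.edgeSet)
    (hmed : ∀ e e' : ↥G.edgeSet, Gmed.Adj e e' ↔
      ∃ v : V, ρ.Consecutive v (e : Sym2 V) (e' : Sym2 V)) :
    sInf {n : ℕ | ∃ α : V → Finset (Finset (Sym2 V)),
        (∀ v, ∀ ang ∈ α v, ang.Nonempty ∧ ρ.IsAngle v ang) ∧
        (∀ e ∈ G.edgeSet, ∃ u, u ∈ e ∧ ∃ ang ∈ α u, e ∈ ang) ∧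
        ∑ v : V, (α v).card = n} =
      G.edgeSet.ncard -
        sSup {m : ℕ | ∃ M : Gmed.Subgraph, M.IsMatching ∧ M.edgeSet.ncard = m} := by
  classical
  set S := {n : ℕ | ∃ α : V → Finset (Finset (Sym2 V)),
        (∀ v, ∀ ang ∈ α v, ang.Nonempty ∧ ρ.IsAngle v ang) ∧
        (∀ e ∈ G.edgeSet, ∃ u, u ∈ e ∧ ∃ ang ∈ α u, e ∈ ang) ∧
        ∑ v : V, (α v).card = n} with hS
  set T := {m : ℕ | ∃ M : Gmed.Subgraph, M.IsMatching ∧ M.edgeSet.ncard = m} with hT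
  have hTb : BddAbove T := by
    refine ⟨G.edgeSet.ncard, ?_⟩
    rintro m ⟨M, hM, rfl⟩
    obtain ⟨α, _, _, h⟩ := aux_upper G ρ Gmed hmed M hM
    omega
  have hTn : T.Nonempty := ⟨_, ⊥, fun v hv => absurd hv (by simp), rfl⟩
  obtain ⟨M, hM, hMν⟩ := Nat.sSup_mem hTn hTb
  obtain ⟨α, a1, a2, a3⟩ := aux_upper G ρ Gmed hmed M hM
  have hαS : ∑ v : V, (α v).card ∈ S := ⟨α, a1, a2, rfl⟩
  have h1 := Nat.sInf_le hαS
  obtain ⟨β, b1, b2, b3⟩ := Nat.sInf_mem ⟨_, hαS⟩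
  obtain ⟨N, hN, hN'⟩ := aux_lower G ρ Gmed hmed β b1 b2
  have h2 : N.edgeSet.ncard ≤ sSup T := le_csSup hTb ⟨N, hN, rfl⟩
  omega
end

section
/- For every finite simple graph G, the graph H = H(G) with rotation system f, constructed as described, admits an angle cover if and only if G admits a proper 3-colouring. Moreover, H(G) has maximum degree 5. -/
open SimpleGraph

/-! ### The NP-hardness gadget `H(G)`

Vertices: centre vertices `c(v)`, path vertices `e^k_j(v)`, and separator vertices
`a^k_j(v)`, `b^k_j(v)`.  Tuples `(v, k, j)` with `j` outside `[1, deg v]` are isolated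
vertices of the gadget graph. -/

abbrev GadgetV (V : Type*) : Type _ :=
  V ⊕ (V × Fin 3 × ℕ) ⊕ (V × Fin 3 × ℕ) ⊕ (V × Fin 3 × ℕ)

/-- The centre vertex `c(v)`. -/
def cV {V : Type*} (v : V) : GadgetV V := Sum.inl v

/-- The path vertex `e^k_j(v)`. -/
def eV {V : Type*} (v : V) (k : Fin 3) (j : ℕ) : GadgetV V :=
  Sum.inr (Sum.inl (v, k, j))

/-- The separator vertex `a^k_j(v)`. -/
def aV {V : Type*} (v : V) (k : Fin 3) (j : ℕ) : GadgetV V :=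
  Sum.inr (Sum.inr (Sum.inl (v, k, j)))

/-- The separator vertex `b^k_j(v)`. -/
def bV {V : Type*} (v : V) (k : Fin 3) (j : ℕ) : GadgetV V :=
  Sum.inr (Sum.inr (Sum.inr (v, k, j)))

/-- The edges of the gadget graph `H(G)`, relative to an enumeration `enum v` of the
edges incident to each vertex `v` of `G` (indexed by `1, …, deg v`):
centre-to-path edges, path edges, separator edges, and cross edges between gadgets. -/
def gadgetRel {V : Type*} (G : SimpleGraph V) (enum : V → ℕ → Sym2 V)
    (p q : GadgetV V) : Prop :=
  (∃ (v : V) (k : Fin 3), 1 ≤ (G.neighborSet v).ncard ∧ p = cV v ∧ q = eV v k 1) ∨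
  (∃ (v : V) (k : Fin 3) (j : ℕ), 1 ≤ j ∧ j + 1 ≤ (G.neighborSet v).ncard ∧
    p = eV v k j ∧ q = eV v k (j + 1)) ∨
  (∃ (v : V) (k : Fin 3) (j : ℕ), 1 ≤ j ∧ j ≤ (G.neighborSet v).ncard ∧
    p = eV v k j ∧ (q = aV v k j ∨ q = bV v k j)) ∨
  (∃ (u v : V) (k : Fin 3) (i j : ℕ), G.Adj u v ∧
    1 ≤ i ∧ i ≤ (G.neighborSet u).ncard ∧ 1 ≤ j ∧ j ≤ (G.neighborSet v).ncard ∧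
    enum u i = s(u, v) ∧ enum v j = s(u, v) ∧ p = eV v k j ∧ q = eV u k i)

/-- The gadget graph `H(G)`. -/
def gadgetGraph {V : Type*} (G : SimpleGraph V) (enum : V → ℕ → Sym2 V) :
    SimpleGraph (GadgetV V) :=
  SimpleGraph.fromRel (gadgetRel G enum)


lemma gg_adj {V : Type*} (G : SimpleGraph V) (enum : V → ℕ → Sym2 V) (p q : GadgetV V) :
    (gadgetGraph G enum).Adj p q ↔ gadgetRel G enum p q ∨ gadgetRel G enum q p := by
  have key : ∀ p q, gadgetRel G enum p q → p ≠ q := by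
    rintro p q (⟨v, k, h, rfl, rfl⟩ | ⟨v, k, j, h1, h2, rfl, rfl⟩ | ⟨v, k, j, h1, h2, rfl, rfl | rfl⟩ |
      ⟨u, v, k, i, j, h, -, -, -, -, -, -, rfl, rfl⟩)
    · simp [cV, eV]
    · simp [eV]
    · simp [aV, eV]
    · simp [bV, eV]
    · have := h.ne
      simp [eV, this.symm]
  unfold gadgetGraph
  rw [SimpleGraph.fromRel_adj]
  constructor
  · exact fun h => h.2
  · intro h
    refine ⟨?_, h⟩
    rcases h with h | h
    · exact key _ _ h
    · exact (key _ _ h).symm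

lemma gg_inc {V : Type*} (H : SimpleGraph V) (x y : V) :
    s(x, y) ∈ H.incidenceSet x ↔ H.Adj x y := by
  simp [SimpleGraph.incidenceSet]

/-- the previous vertex on the path -/
def prevV {V : Type*} (v : V) (k : Fin 3) (j : ℕ) : GadgetV V :=
  if j = 1 then cV v else eV v k (j - 1)

lemma gg_partner {V : Type*} (G : SimpleGraph V) (enum : V → ℕ → Sym2 V)
    (henum : ∀ v : V,
      Set.BijOn (enum v) (Set.Icc 1 (G.neighborSet v).ncard) (G.incidenceSet v))
    (v : V) (j : ℕ) (h1 : 1 ≤ j) (h2 : j ≤ (G.neighborSet v).ncard) :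
    ∃ u i, G.Adj u v ∧ 1 ≤ i ∧ i ≤ (G.neighborSet u).ncard ∧ enum v j = s(u, v) ∧
      enum u i = s(u, v) := by
  have hm := (henum v).mapsTo ⟨h1, h2⟩
  obtain ⟨u, hu⟩ := Sym2.mem_iff_exists.1 hm.2
  have ha : G.Adj v u := by
    have := hm.1
    rw [hu] at this
    exact this
  have hm2 : s(v, u) ∈ G.incidenceSet u := by
    simp [SimpleGraph.incidenceSet, ha]
  obtain ⟨i, hi, hiu⟩ := (henum u).surjOn hm2
  exact ⟨u, i, ha.symm, hi.1, hi.2, by rw [hu, Sym2.eq_swap], by rw [hiu, Sym2.eq_swap]⟩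

lemma gg_ncard5 {α : Type*} (a b c d e : α) : ({a, b, c, d, e} : Set α).ncard ≤ 5 := by
  classical
  have : ({a, b, c, d, e} : Set α) = (({a, b, c, d, e} : Finset α) : Set α) := by simp
  rw [this, Set.ncard_coe_finset]
  exact Finset.card_le_five

lemma gg_deg {V : Type*} (G : SimpleGraph V) (enum : V → ℕ → Sym2 V)
    (henum : ∀ v : V,
      Set.BijOn (enum v) (Set.Icc 1 (G.neighborSet v).ncard) (G.incidenceSet v))
    (w : GadgetV V) : ((gadgetGraph G enum).neighborSet w).ncard ≤ 5 := by
  suffices h : ∃ a b c d e, (gadgetGraph G enum).neighborSet w ⊆ {a, b, c, d, e} by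
    obtain ⟨a, b, c, d, e, h⟩ := h
    exact (Set.ncard_le_ncard h (by simp)).trans (gg_ncard5 a b c d e)
  rcases w with v | ⟨v, k, j⟩ | ⟨v, k, j⟩ | ⟨v, k, j⟩
  · refine ⟨eV v 0 1, eV v 1 1, eV v 2 1, eV v 2 1, eV v 2 1, ?_⟩
    intro q hq
    rw [SimpleGraph.mem_neighborSet, gg_adj] at hq
    simp only [gadgetRel, cV, eV, aV, bV] at hq
    rcases hq with (⟨v', k', h, h1, rfl⟩ | ⟨v', k', j', h1, h2, h3, h4⟩ | ⟨v', k', j', h1, h2, h3, h4⟩ | ⟨u, v', k', i, j', h, -, -, -, -, -, -, h1, h2⟩) | (⟨v', k', h, h1, h2⟩ | ⟨v', k', j', h1, h2, h3, h4⟩ | ⟨v', k', j', h1, h2, h3, h4⟩ | ⟨u, v', k', i, j', h, -, -, -, -, -, -, h1, h2⟩)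
    · obtain rfl := Sum.inl.inj h1
      fin_cases k' <;> simp [eV]
    all_goals simp_all
  · by_cases hj : 1 ≤ j ∧ j ≤ (G.neighborSet v).ncard
    · obtain ⟨u, i, ha, hi1, hi2, e1, e2⟩ := gg_partner G enum henum v j hj.1 hj.2
      refine ⟨prevV v k j, aV v k j, eV u k i, eV v k (j+1), bV v k j, ?_⟩
      have huniq : ∀ u' i', 1 ≤ i' → i' ≤ (G.neighborSet u').ncard → enum v j = s(u', v) →
          enum u' i' = s(u', v) → u' = u ∧ i' = i := by
        intro u' i' h1 h2 h3 h4
        have : u' = u := by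
          rw [e1] at h3
          exact (Sym2.congr_left.1 h3).symm
        subst this
        exact ⟨rfl, (henum u').injOn ⟨h1, h2⟩ ⟨hi1, hi2⟩ (h4.trans e2.symm)⟩
      intro q hq
      rw [SimpleGraph.mem_neighborSet, gg_adj] at hq
      simp only [gadgetRel] at hq
      rcases hq with (⟨v', k', h, h1, h2⟩ | ⟨v', k', j', h1, h2, h3, rfl⟩ | ⟨v', k', j', h1, h2, h3, h4⟩ | ⟨u', v', k', i', j', h, g1, g2, g3, g4, g5, g6, h1, rfl⟩) | (⟨v', k', h, rfl, h2⟩ | ⟨v', k', j', h1, h2, rfl, h4⟩ | ⟨v', k', j', h1, h2, h3, h4⟩ | ⟨u', v', k', i', j', h, g1, g2, g3, g4, g5, g6, rfl, h2⟩)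
      · simp [cV] at h1
      · simp only [eV, Sum.inr.injEq, Sum.inl.injEq, Prod.mk.injEq] at h3
        obtain ⟨rfl, rfl, rfl⟩ := h3
        simp
      · simp only [eV, Sum.inr.injEq, Sum.inl.injEq, Prod.mk.injEq] at h3
        obtain ⟨rfl, rfl, rfl⟩ := h3
        rcases h4 with rfl | rfl <;> simp
      · simp only [eV, Sum.inr.injEq, Sum.inl.injEq, Prod.mk.injEq] at h1
        obtain ⟨rfl, rfl, rfl⟩ := h1
        obtain ⟨rfl, rfl⟩ := huniq u' i' g1 g2 g6 g5
        simp
      · simp only [eV, Sum.inr.injEq, Sum.inl.injEq, Prod.mk.injEq] at h2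
        obtain ⟨rfl, rfl, rfl⟩ := h2
        simp [prevV]
      · simp only [eV, Sum.inr.injEq, Sum.inl.injEq, Prod.mk.injEq] at h4
        obtain ⟨rfl, rfl, rfl⟩ := h4
        have : j' ≠ 0 := by omega
        simp [prevV, this]
      · simp [eV, aV, bV] at h4
      · simp only [eV, Sum.inr.injEq, Sum.inl.injEq, Prod.mk.injEq] at h2
        obtain ⟨rfl, rfl, rfl⟩ := h2
        obtain ⟨rfl, rfl⟩ := huniq v' j' g3 g4 (g5.trans Sym2.eq_swap) (g6.trans Sym2.eq_swap)
        simp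
    · refine ⟨cV v, cV v, cV v, cV v, cV v, ?_⟩
      intro q hq
      exfalso
      apply hj
      rw [SimpleGraph.mem_neighborSet, gg_adj] at hq
      simp only [gadgetRel] at hq
      rcases hq with (⟨v', k', h, h1, h2⟩ | ⟨v', k', j', h1, h2, h3, rfl⟩ | ⟨v', k', j', h1, h2, h3, h4⟩ | ⟨u', v', k', i', j', h, g1, g2, g3, g4, g5, g6, h3, rfl⟩) | (⟨v', k', h, rfl, h3⟩ | ⟨v', k', j', h1, h2, rfl, h3⟩ | ⟨v', k', j', h1, h2, h0, h3⟩ | ⟨u', v', k', i', j', h, g1, g2, g3, g4, g5, g6, rfl, h3⟩)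
      · simp [cV] at h1
      all_goals first
        | (simp only [eV, Sum.inr.injEq, Sum.inl.injEq, Prod.mk.injEq] at h3
           obtain ⟨rfl, rfl, rfl⟩ := h3
           constructor <;> omega)
        | simp [eV, aV, bV] at h3
  · refine ⟨eV v k j, eV v k j, eV v k j, eV v k j, eV v k j, ?_⟩
    intro q hq
    rw [SimpleGraph.mem_neighborSet, gg_adj] at hq
    simp only [gadgetRel, cV, eV, aV, bV] at hq
    simp only [eV]
    aesop
  · refine ⟨eV v k j, eV v k j, eV v k j, eV v k j, eV v k j, ?_⟩
    intro q hq
    rw [SimpleGraph.mem_neighborSet, gg_adj] at hq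
    simp only [gadgetRel, cV, eV, aV, bV] at hq
    simp only [eV]
    aesop

lemma gg_prev_ne {V : Type*} (v : V) (k : Fin 3) (j : ℕ) :
    prevV v k j ≠ aV v k j ∧ prevV v k j ≠ bV v k j ∧ prevV v k j ≠ eV v k (j+1) ∧
    ∀ u k' i, u ≠ v → prevV v k j ≠ eV u k' i := by
  unfold prevV
  split_ifs <;> simp [cV, eV, aV, bV]
  · intro u k' i h1 h2
    exact absurd h2.symm h1

lemma gg_three {α : Type*} (σ : Equiv.Perm α) (S : Set α) (x y z : α)
    (hS : ∀ w ∈ S, w = x ∨ w = y ∨ w = z) (hx : x ∈ S) (hy : y ∈ S) (hxy : x ≠ y)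
    (hfix : ∀ w, w ∉ S → σ w = w)
    (hc : ∀ e ∈ S, ∀ e' ∈ S, ∃ n : ℕ, (σ ^ n) e = e') : σ x = y ∨ σ y = x := by
  have hmem : ∀ w ∈ S, σ w ∈ S := by
    intro w hw
    by_contra h
    have := σ.injective (hfix _ h)
    rw [this] at h
    exact h hw
  have hpow : ∀ w, σ w = w → ∀ n : ℕ, (σ ^ n) w = w := by
    intro w hw n
    induction n with
    | zero => rfl
    | succ n ih => rw [pow_succ, Equiv.Perm.mul_apply, hw, ih]
  have h1 : σ x ≠ x := by
    intro h
    obtain ⟨n, hn⟩ := hc x hx y hy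
    rw [hpow x h] at hn
    exact hxy hn
  have h2 : σ y ≠ y := by
    intro h
    obtain ⟨n, hn⟩ := hc y hy x hx
    rw [hpow y h] at hn
    exact hxy hn.symm
  rcases hS _ (hmem x hx) with h | h | h
  · exact absurd h h1
  · exact Or.inl h
  · rcases hS _ (hmem y hy) with h' | h' | h'
    · exact Or.inr h'
    · exact absurd h' h2
    · exact absurd (σ.injective (h.trans h'.symm)) hxy

set_option maxHeartbeats 2000000 in
/-- The gadget graph `H(G)` has maximum degree 5, and (for any rotation system whose
cyclic order at each path vertex `e^k_j(v)` is
`[e^k_{j−1}(v), a^k_j(v), e^k_i(u), e^k_{j+1}(v), b^k_j(v)]`, where `e^k_0(v) = c(v)`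
and the entry `e^k_{j+1}(v)` is omitted when `j = deg v`) it admits an angle cover if
and only if `G` is properly 3-colourable. -/
theorem gadget_angleCover_iff_three_colourable {V : Type*} [Fintype V] [DecidableEq V]
    (G : SimpleGraph V) (enum : V → ℕ → Sym2 V)
    (henum : ∀ v : V,
      Set.BijOn (enum v) (Set.Icc 1 (G.neighborSet v).ncard) (G.incidenceSet v))
    (ρ : RotationSystem (gadgetGraph G enum))
    (hrot : ∀ (v u : V) (k : Fin 3) (j i : ℕ), G.Adj u v →
      1 ≤ j → j ≤ (G.neighborSet v).ncard →
      1 ≤ i → i ≤ (G.neighborSet u).ncard →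
      enum v j = s(u, v) → enum u i = s(u, v) →
      ∀ P : GadgetV V, P = (if j = 1 then cV v else eV v k (j - 1)) →
        ρ.rot (eV v k j) s(eV v k j, P) = s(eV v k j, aV v k j) ∧
        ρ.rot (eV v k j) s(eV v k j, aV v k j) = s(eV v k j, eV u k i) ∧
        (j < (G.neighborSet v).ncard →
          ρ.rot (eV v k j) s(eV v k j, eV u k i) = s(eV v k j, eV v k (j + 1)) ∧
          ρ.rot (eV v k j) s(eV v k j, eV v k (j + 1)) = s(eV v k j, bV v k j)) ∧
        (j = (G.neighborSet v).ncard →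
          ρ.rot (eV v k j) s(eV v k j, eV u k i) = s(eV v k j, bV v k j)) ∧
        ρ.rot (eV v k j) s(eV v k j, bV v k j) = s(eV v k j, P)) :
    (∀ w : GadgetV V, ((gadgetGraph G enum).neighborSet w).ncard ≤ 5) ∧
      ((∃ A : GadgetV V → Finset (Sym2 (GadgetV V)), ρ.IsAngleCover A) ↔
        G.Colorable 3) := by
  classical
  refine ⟨gg_deg G enum henum, ?_, ?_⟩
  · rintro ⟨A, hA1, hA2, hA3, hA4⟩
    have hcol : ∀ v, ∃ k : Fin 3, s(cV v, eV v k 1) ∉ A (cV v) := by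
      intro v
      by_contra! h
      have hsub : (Finset.univ : Finset (Fin 3)).image (fun k => s(cV v, eV v k 1)) ⊆ A (cV v) := by
        intro e he
        obtain ⟨k, -, rfl⟩ := Finset.mem_image.1 he
        exact h k
      have := (Finset.card_le_card hsub).trans (hA1 (cV v))
      rw [Finset.card_image_of_injective] at this
      · simp at this
      · intro k k' h
        simpa [cV, eV] using h
    choose col hcol using hcol
    have hcov : ∀ p q, (gadgetGraph G enum).Adj p q → s(p, q) ∈ A p ∨ s(p, q) ∈ A q := by
      intro p q h
      obtain ⟨w, hw, hm⟩ := hA4 s(p, q) h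
      rcases Sym2.mem_iff.1 hw with rfl | rfl
      · exact Or.inl hm
      · exact Or.inr hm
    have hnot : ∀ v k j, 1 ≤ j → j ≤ (G.neighborSet v).ncard →
        s(eV v k j, prevV v k j) ∈ A (eV v k j) →
        (∀ u i, G.Adj u v → 1 ≤ i → i ≤ (G.neighborSet u).ncard → enum v j = s(u, v) →
          enum u i = s(u, v) → s(eV v k j, eV u k i) ∉ A (eV v k j)) ∧
        (j < (G.neighborSet v).ncard → s(eV v k j, eV v k (j+1)) ∉ A (eV v k j)) := by
      intro v k j h1 h2 hm
      obtain ⟨n1, n2, n3, n4⟩ := gg_prev_ne v k j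
      constructor
      · intro u i ha hi1 hi2 e1 e2 hx
        obtain ⟨r1, r2, r3, r4, r5⟩ := hrot v u k j i ha h1 h2 hi1 hi2 e1 e2 (prevV v k j) rfl
        have hne : prevV v k j ≠ eV u k i := n4 u k i ha.ne
        obtain ⟨-, -, -, h | h⟩ := hA3 _ _ hm _ hx (fun h => hne (Sym2.congr_right.1 h))
        · rw [r1, Sym2.congr_right] at h
          simp [aV, eV] at h
        · rcases h2.lt_or_eq with h2 | h2
          · rw [(r3 h2).1, Sym2.congr_right] at h
            exact n3 h.symm
          · rw [r4 h2, Sym2.congr_right] at h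
            exact n2 h.symm
      · intro hlt hx
        obtain ⟨u, i, ha, hi1, hi2, e1, e2⟩ := gg_partner G enum henum v j h1 h2
        obtain ⟨r1, r2, r3, r4, r5⟩ := hrot v u k j i ha h1 h2 hi1 hi2 e1 e2 (prevV v k j) rfl
        obtain ⟨-, -, -, h | h⟩ := hA3 _ _ hm _ hx (fun h => n3 (Sym2.congr_right.1 h))
        · rw [r1, Sym2.congr_right] at h
          simp [aV, eV] at h
        · rw [(r3 hlt).2, Sym2.congr_right] at h
          exact n2 h.symm
    have hprev : ∀ v j, 1 ≤ j → j ≤ (G.neighborSet v).ncard →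
        s(eV v (col v) j, prevV v (col v) j) ∈ A (eV v (col v) j) := by
      intro v j h1
      induction j, h1 using Nat.le_induction with
      | base =>
        intro h
        have hadj : (gadgetGraph G enum).Adj (cV v) (eV v (col v) 1) := by
          rw [gg_adj]
          exact Or.inl (Or.inl ⟨v, col v, h, rfl, rfl⟩)
        rcases hcov _ _ hadj with h | h
        · exact absurd h (hcol v)
        · rw [Sym2.eq_swap]
          exact h
      | succ j h1 ih =>
        intro h
        have hadj : (gadgetGraph G enum).Adj (eV v (col v) j) (eV v (col v) (j+1)) := by
          rw [gg_adj]
          exact Or.inl (Or.inr (Or.inl ⟨v, col v, j, h1, h, rfl, rfl⟩))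
        have hp : prevV v (col v) (j+1) = eV v (col v) j := by
          have : j ≠ 0 := by omega
          simp [prevV, this]
        rw [hp]
        rcases hcov _ _ hadj with h' | h'
        · exact absurd h' ((hnot v (col v) j h1 (by omega) (ih (by omega))).2 h)
        · rw [Sym2.eq_swap]
          exact h'
    refine ⟨SimpleGraph.Coloring.mk col ?_⟩
    intro v u hvu heq
    have hm : s(u, v) ∈ G.incidenceSet v := by simp [SimpleGraph.incidenceSet, hvu.symm]
    obtain ⟨j, ⟨h1, h2⟩, hj⟩ := (henum v).surjOn hm
    have hm : s(u, v) ∈ G.incidenceSet u := by simp [SimpleGraph.incidenceSet, hvu.symm]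
    obtain ⟨i, ⟨h3, h4⟩, hi⟩ := (henum u).surjOn hm
    have hadj : (gadgetGraph G enum).Adj (eV v (col v) j) (eV u (col v) i) := by
      rw [gg_adj]
      exact Or.inl (Or.inr (Or.inr (Or.inr ⟨u, v, col v, i, j, hvu.symm, h3, h4, h1, h2, hi, hj, rfl, rfl⟩)))
    rcases hcov _ _ hadj with h | h
    · exact (hnot v _ j h1 h2 (hprev v j h1 h2)).1 u i hvu.symm h3 h4 hj hi h
    · have hp := hprev u i h3 h4
      rw [← heq] at hp
      rw [Sym2.eq_swap] at h
      exact (hnot u _ i h3 h4 hp).1 v j hvu h1 h2 (hi.trans Sym2.eq_swap) (hj.trans Sym2.eq_swap) h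
  · rintro ⟨col⟩
    have hpart : ∀ v j, ∃ u i, 1 ≤ j → j ≤ (G.neighborSet v).ncard →
        G.Adj u v ∧ 1 ≤ i ∧ i ≤ (G.neighborSet u).ncard ∧ enum v j = s(u, v) ∧
          enum u i = s(u, v) := by
      intro v j
      by_cases h : 1 ≤ j ∧ j ≤ (G.neighborSet v).ncard
      · obtain ⟨u, i, h⟩ := gg_partner G enum henum v j h.1 h.2
        exact ⟨u, i, fun _ _ => h⟩
      · exact ⟨v, j, fun h1 h2 => absurd ⟨h1, h2⟩ h⟩
    choose U I hUI using hpart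
    -- path and separator adjacency
    have adjc : ∀ v k, 1 ≤ (G.neighborSet v).ncard → (gadgetGraph G enum).Adj (cV v) (eV v k 1) := by
      intro v k h
      rw [gg_adj]
      exact Or.inl (Or.inl ⟨v, k, h, rfl, rfl⟩)
    have adjn : ∀ v k j, 1 ≤ j → j < (G.neighborSet v).ncard →
        (gadgetGraph G enum).Adj (eV v k j) (eV v k (j+1)) := by
      intro v k j h1 h2
      rw [gg_adj]
      exact Or.inl (Or.inr (Or.inl ⟨v, k, j, h1, h2, rfl, rfl⟩))
    have adja : ∀ v k j, 1 ≤ j → j ≤ (G.neighborSet v).ncard →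
        (gadgetGraph G enum).Adj (eV v k j) (aV v k j) := by
      intro v k j h1 h2
      rw [gg_adj]
      exact Or.inl (Or.inr (Or.inr (Or.inl ⟨v, k, j, h1, h2, rfl, Or.inl rfl⟩)))
    have adjb : ∀ v k j, 1 ≤ j → j ≤ (G.neighborSet v).ncard →
        (gadgetGraph G enum).Adj (eV v k j) (bV v k j) := by
      intro v k j h1 h2
      rw [gg_adj]
      exact Or.inl (Or.inr (Or.inr (Or.inl ⟨v, k, j, h1, h2, rfl, Or.inr rfl⟩)))
    have adjp : ∀ v k j, 1 ≤ j → j ≤ (G.neighborSet v).ncard →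
        (gadgetGraph G enum).Adj (eV v k j) (prevV v k j) := by
      intro v k j h1 h2
      unfold prevV
      split_ifs with h
      · subst h
        exact (adjc v k h2).symm
      · have := adjn v k (j-1) (by omega) (by omega)
        rw [Nat.sub_add_cancel h1] at this
        exact this.symm
    have adjx : ∀ v k j, 1 ≤ j → j ≤ (G.neighborSet v).ncard →
        (gadgetGraph G enum).Adj (eV v k j) (eV (U v j) k (I v j)) := by
      intro v k j h1 h2
      obtain ⟨g1, g2, g3, g4, g5⟩ := hUI v j h1 h2
      rw [gg_adj]
      exact Or.inl (Or.inr (Or.inr (Or.inr ⟨U v j, v, k, I v j, j, g1, g2, g3, h1, h2, g5, g4, rfl, rfl⟩)))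
    -- the cover, given by pairs of vertices
    let N : GadgetV V → Finset (GadgetV V) := fun w => match w with
      | Sum.inl v => if 1 ≤ (G.neighborSet v).ncard then
          (Finset.univ.erase (col v)).image (fun k => eV v k 1) else ∅
      | Sum.inr (Sum.inl (v, k, j)) =>
          if 1 ≤ j ∧ j ≤ (G.neighborSet v).ncard then
            if k = col v then {prevV v k j, aV v k j} else
              if j < (G.neighborSet v).ncard then {eV (U v j) k (I v j), eV v k (j+1)}
              else {eV (U v j) k (I v j)}
          else ∅
      | Sum.inr (Sum.inr (Sum.inl (v, k, j))) =>
          if 1 ≤ j ∧ j ≤ (G.neighborSet v).ncard then {eV v k j} else ∅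
      | Sum.inr (Sum.inr (Sum.inr (v, k, j))) =>
          if 1 ≤ j ∧ j ≤ (G.neighborSet v).ncard then {eV v k j} else ∅
    have Nc : ∀ v, N (cV v) = if 1 ≤ (G.neighborSet v).ncard then
          (Finset.univ.erase (col v)).image (fun k => eV v k 1) else ∅ := fun v => rfl
    have Ne : ∀ v k j, N (eV v k j) = if 1 ≤ j ∧ j ≤ (G.neighborSet v).ncard then
            if k = col v then {prevV v k j, aV v k j} else
              if j < (G.neighborSet v).ncard then {eV (U v j) k (I v j), eV v k (j+1)}
              else {eV (U v j) k (I v j)}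
          else ∅ := fun v k j => rfl
    have Na : ∀ v k j, N (aV v k j) =
          if 1 ≤ j ∧ j ≤ (G.neighborSet v).ncard then {eV v k j} else ∅ := fun v k j => rfl
    have Nb : ∀ v k j, N (bV v k j) =
          if 1 ≤ j ∧ j ≤ (G.neighborSet v).ncard then {eV v k j} else ∅ := fun v k j => rfl
    clear_value N
    have cases4 : ∀ w : GadgetV V, (∃ v, w = cV v) ∨ (∃ v k j, w = eV v k j) ∨
        (∃ v k j, w = aV v k j) ∨ (∃ v k j, w = bV v k j) := by
      rintro (v | ⟨v, k, j⟩ | ⟨v, k, j⟩ | ⟨v, k, j⟩)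
      · exact Or.inl ⟨v, rfl⟩
      · exact Or.inr (Or.inl ⟨v, k, j, rfl⟩)
      · exact Or.inr (Or.inr (Or.inl ⟨v, k, j, rfl⟩))
      · exact Or.inr (Or.inr (Or.inr ⟨v, k, j, rfl⟩))
    have Ncard : ∀ w, (N w).card ≤ 2 := by
      intro w
      rcases cases4 w with ⟨v, rfl⟩ | ⟨v, k, j, rfl⟩ | ⟨v, k, j, rfl⟩ | ⟨v, k, j, rfl⟩
      · rw [Nc]
        split_ifs
        · refine Finset.card_image_le.trans ?_
          simp
        · simp
      · rw [Ne]
        split_ifs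
        · exact Finset.card_le_two
        · exact Finset.card_le_two
        · simp
        · simp
      · rw [Na]
        split_ifs <;> simp
      · rw [Nb]
        split_ifs <;> simp
    have Nadj : ∀ w, ∀ q ∈ N w, (gadgetGraph G enum).Adj w q := by
      intro w q hq
      rcases cases4 w with ⟨v, rfl⟩ | ⟨v, k, j, rfl⟩ | ⟨v, k, j, rfl⟩ | ⟨v, k, j, rfl⟩
      · rw [Nc] at hq
        split_ifs at hq with h
        · obtain ⟨k, -, rfl⟩ := Finset.mem_image.1 hq
          exact adjc v k h
        · simp at hq
      · rw [Ne] at hq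
        split_ifs at hq with h h' h''
        · rcases (by simpa using hq : q = prevV v k j ∨ q = aV v k j) with rfl | rfl
          · exact adjp v k j h.1 h.2
          · exact adja v k j h.1 h.2
        · rcases (by simpa using hq : q = eV (U v j) k (I v j) ∨ q = eV v k (j+1)) with rfl | rfl
          · exact adjx v k j h.1 h.2
          · exact adjn v k j h.1 h''
        · obtain rfl := Finset.mem_singleton.1 hq
          exact adjx v k j h.1 h.2
        · simp at hq
      · rw [Na] at hq
        split_ifs at hq with h
        · obtain rfl := Finset.mem_singleton.1 hq
          exact (adja v k j h.1 h.2).symm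
        · simp at hq
      · rw [Nb] at hq
        split_ifs at hq with h
        · obtain rfl := Finset.mem_singleton.1 hq
          exact (adjb v k j h.1 h.2).symm
        · simp at hq
    have Ncons : ∀ w, ∀ q ∈ N w, ∀ q' ∈ N w, q ≠ q' →
        ρ.rot w s(w, q) = s(w, q') ∨ ρ.rot w s(w, q') = s(w, q) := by
      intro w q hq q' hq' hne
      rcases cases4 w with ⟨v, rfl⟩ | ⟨v, k, j, rfl⟩ | ⟨v, k, j, rfl⟩ | ⟨v, k, j, rfl⟩
      · have ha := Nadj _ _ hq
        have ha' := Nadj _ _ hq'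
        rw [Nc] at hq hq'
        split_ifs at hq hq' with h
        · obtain ⟨k, hk, rfl⟩ := Finset.mem_image.1 hq
          obtain ⟨k', hk', rfl⟩ := Finset.mem_image.1 hq'
          have hk := (Finset.mem_erase.1 hk).1
          have hk' := (Finset.mem_erase.1 hk').1
          have hkk : k ≠ k' := by
            rintro rfl
            exact hne rfl
          refine gg_three (ρ.rot (cV v)) ((gadgetGraph G enum).incidenceSet (cV v)) _ _
            s(cV v, eV v (col v) 1) ?_ ((gg_inc _ _ _).2 ha) ((gg_inc _ _ _).2 ha')
            (fun h => hne (Sym2.congr_right.1 h)) (ρ.fixes _) (ρ.cyclic _)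
          intro e he
          obtain ⟨q, rfl⟩ := Sym2.mem_iff_exists.1 he.2
          rw [gg_inc, gg_adj] at he
          have : ∃ k, q = eV v k 1 := by
            simp only [gadgetRel] at he
            simp only [cV, eV, aV, bV] at he ⊢
            aesop
          obtain ⟨k₁, rfl⟩ := this
          have : k₁ = k ∨ k₁ = k' ∨ k₁ = col v := by
            generalize col v = c at *
            clear * - hk hk' hkk
            revert k k' c k₁
            decide
          rcases this with rfl | rfl | rfl <;> simp
        · simp at hq
      · rw [Ne] at hq hq'
        split_ifs at hq hq' with h h' h''
        · obtain ⟨g1, g2, g3, g4, g5⟩ := hUI v j h.1 h.2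
          obtain ⟨r1, r2, r3, r4, r5⟩ := hrot v _ k j _ g1 h.1 h.2 g2 g3 g4 g5 (prevV v k j) rfl
          rcases (by simpa using hq : q = prevV v k j ∨ q = aV v k j) with rfl | rfl <;>
          rcases (by simpa using hq' : q' = prevV v k j ∨ q' = aV v k j) with rfl | rfl
          · exact absurd rfl hne
          · exact Or.inl r1
          · exact Or.inr r1
          · exact absurd rfl hne
        · obtain ⟨g1, g2, g3, g4, g5⟩ := hUI v j h.1 h.2
          obtain ⟨r1, r2, r3, r4, r5⟩ := hrot v _ k j _ g1 h.1 h.2 g2 g3 g4 g5 (prevV v k j) rfl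
          have r := (r3 h'').1
          rcases (by simpa using hq : q = eV (U v j) k (I v j) ∨ q = eV v k (j+1)) with rfl | rfl <;>
          rcases (by simpa using hq' : q' = eV (U v j) k (I v j) ∨ q' = eV v k (j+1)) with rfl | rfl
          · exact absurd rfl hne
          · exact Or.inl r
          · exact Or.inr r
          · exact absurd rfl hne
        · exact absurd ((Finset.mem_singleton.1 hq).trans (Finset.mem_singleton.1 hq').symm) hne
        · simp at hq
      · rw [Na] at hq hq'
        split_ifs at hq hq'
        · exact absurd ((Finset.mem_singleton.1 hq).trans (Finset.mem_singleton.1 hq').symm) hne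
        · simp at hq
      · rw [Nb] at hq hq'
        split_ifs at hq hq'
        · exact absurd ((Finset.mem_singleton.1 hq).trans (Finset.mem_singleton.1 hq').symm) hne
        · simp at hq
    have Ncov : ∀ p q, gadgetRel G enum p q → q ∈ N p ∨ p ∈ N q := by
      rintro p q (⟨v, k, h, rfl, rfl⟩ | ⟨v, k, j, h1, h2, rfl, rfl⟩ | ⟨v, k, j, h1, h2, rfl, rfl | rfl⟩ |
        ⟨u, v, k, i, j, h, h1, h2, h3, h4, h5, h6, rfl, rfl⟩)
      · by_cases hk : k = col v
        · right
          rw [Ne, if_pos ⟨le_rfl, h⟩, if_pos hk]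
          simp [prevV]
        · left
          rw [Nc, if_pos h]
          exact Finset.mem_image.2 ⟨k, by simp [hk], rfl⟩
      · by_cases hk : k = col v
        · right
          rw [Ne, if_pos ⟨by omega, h2⟩, if_pos hk]
          have : j ≠ 0 := by omega
          simp [prevV, this]
        · left
          rw [Ne, if_pos ⟨h1, by omega⟩, if_neg hk, if_pos (by omega)]
          simp
      · right
        rw [Na, if_pos ⟨h1, h2⟩]
        simp
      · right
        rw [Nb, if_pos ⟨h1, h2⟩]
        simp
      · have key : ∀ u v i j, G.Adj u v → 1 ≤ i → i ≤ (G.neighborSet u).ncard → 1 ≤ j →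
            j ≤ (G.neighborSet v).ncard → enum u i = s(u, v) → enum v j = s(u, v) → k ≠ col v →
            eV u k i ∈ N (eV v k j) := by
          intro u v i j h h1 h2 h3 h4 h5 h6 hk
          obtain ⟨g1, g2, g3, g4, g5⟩ := hUI v j h3 h4
          have hu : u = U v j := Sym2.congr_left.1 (h6.symm.trans g4)
          have hi : i = I v j := by
            rw [← hu] at g3 g5
            exact (henum u).injOn ⟨h1, h2⟩ ⟨g2, g3⟩ (h5.trans g5.symm)
          rw [Ne, if_pos ⟨h3, h4⟩, if_neg hk, ← hu, ← hi]
          split_ifs <;> simp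
        by_cases hk : k = col v
        · right
          refine key v u j i h.symm h3 h4 h1 h2 (h6.trans Sym2.eq_swap) (h5.trans Sym2.eq_swap) ?_
          rw [hk]
          exact (col.valid h).symm
        · left
          exact key u v i j h h1 h2 h3 h4 h5 h6 hk
    refine ⟨fun w => (N w).image (fun q => s(w, q)), ?_, ?_, ?_, ?_⟩
    · exact fun w => Finset.card_image_le.trans (Ncard w)
    · intro w e he
      obtain ⟨q, hq, rfl⟩ := Finset.mem_image.1 he
      exact (gg_inc _ _ _).2 (Nadj _ _ hq)
    · intro w e he e' he' hne
      obtain ⟨q, hq, rfl⟩ := Finset.mem_image.1 he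
      obtain ⟨q', hq', rfl⟩ := Finset.mem_image.1 he'
      refine ⟨hne, (gg_inc _ _ _).2 (Nadj _ _ hq), (gg_inc _ _ _).2 (Nadj _ _ hq'), ?_⟩
      refine Ncons w q hq q' hq' ?_
      rintro rfl
      exact hne rfl
    · intro e he
      induction e using Sym2.ind with
      | _ p q =>
        have h' : q ∈ N p ∨ p ∈ N q := by
          rcases (gg_adj G enum p q).1 he with h | h
          · exact Ncov _ _ h
          · exact (Ncov _ _ h).symm
        rcases h' with h | h
        · exact ⟨p, by simp, Finset.mem_image.2 ⟨q, h, rfl⟩⟩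
        · exact ⟨q, by simp, Finset.mem_image.2 ⟨p, h, Sym2.eq_swap⟩⟩
end
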